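/- arXiv:2401.14825 — 3 statements merged into one kernel-verified Lean document; each statement's English description precedes it below -/
import Mathlib

section
/- For a path graph and three agents with additive utility functions, there always exists a connected allocation that is PMMS. -/
namespace GraphFair

variable {V : Type*}

/-- A bundle is connected if it is empty or induces a connected subgraph of `G`. -/
def BundleConn (G : SimpleGraph V) (B : Finset V) : Prop :=
  B = ∅ ∨ (G.induce (B : Set V)).Connected

/-- A connected allocation of all the items among `n` agents: the bundles cover `V`,
are pairwise disjoint, and each bundle is connected in `G`. -/
def IsConnAlloc (G : SimpleGraph V) {n : ℕ} (A : Fin n → Finset V) : Prop :=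
  (∀ v : V, ∃ i, v ∈ A i) ∧
  (∀ i j : Fin n, i ≠ j → Disjoint (A i) (A j)) ∧
  (∀ i, BundleConn G (A i))

variable [DecidableEq V]

/-- Partitions of `X` into two bundles, each connected in the induced subgraph `G[X]`
(for `Y ⊆ X`, connectivity of `Y` in `G[X]` is the same as connectivity of `Y` in `G`). -/
def Part2 (G : SimpleGraph V) (X : Finset V) : Set (Finset V × Finset V) :=
  {p | p.1 ∪ p.2 = X ∧ Disjoint p.1 p.2 ∧ BundleConn G p.1 ∧ BundleConn G p.2}

/-- The pairwise maximin share of a bundle `X` with respect to utility `u`: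
the maximum over partitions of `X` into two connected bundles of the minimum utility. -/
noncomputable def pmms (G : SimpleGraph V) (u : Finset V → ℝ) (X : Finset V) : ℝ :=
  sSup ((fun p : Finset V × Finset V => min (u p.1) (u p.2)) '' Part2 G X)

/-- The `n`-agent maximin share of the whole vertex set: maximum over partitions of `V`
into `n` connected bundles of the minimum utility of a bundle. -/
noncomputable def mms (G : SimpleGraph V) (u : Finset V → ℝ) (n : ℕ) : ℝ :=
  sSup ((fun A : Fin n → Finset V => ⨅ i, u (A i)) '' {A | IsConnAlloc G A})

/-- Agents `i` and `j` are adjacent under allocation `A`. -/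
def AdjUnder (G : SimpleGraph V) {n : ℕ} (A : Fin n → Finset V) (i j : Fin n) : Prop :=
  ∃ v ∈ A i, ∃ w ∈ A j, G.Adj v w

/-- An allocation is `α`-PMMS if every agent with an empty bundle, and every agent with
respect to each of her neighbours, receives at least `α` times her pairwise maximin share. -/
def IsAlphaPMMS (G : SimpleGraph V) {n : ℕ} (u : Fin n → Finset V → ℝ)
    (A : Fin n → Finset V) (α : ℝ) : Prop :=
  ∀ i j : Fin n, i ≠ j → (A i = ∅ ∨ AdjUnder G A i j) →
    α * pmms G (u i) (A i ∪ A j) ≤ u i (A i)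

/-- An allocation is `α`-MMS if every agent receives at least `α` times her maximin share. -/
def IsAlphaMMS (G : SimpleGraph V) {n : ℕ} (u : Fin n → Finset V → ℝ)
    (A : Fin n → Finset V) (α : ℝ) : Prop :=
  ∀ i : Fin n, α * mms G (u i) n ≤ u i (A i)

/-- An additive (nonnegative) utility function. -/
def AdditiveUtil (u : Finset V → ℝ) : Prop :=
  (∀ X : Finset V, u X = ∑ v ∈ X, u {v}) ∧ ∀ v : V, 0 ≤ u {v}

/-- A binary additive utility function. -/
def BinaryAdditiveUtil (u : Finset V → ℝ) : Prop :=
  (∀ X : Finset V, u X = ∑ v ∈ X, u {v}) ∧ ∀ v : V, u {v} = 0 ∨ u {v} = 1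

/-- A monotone (nonnegative) utility function. -/
def MonotoneUtil (u : Finset V → ℝ) : Prop :=
  (∀ X Y : Finset V, X ⊆ Y → u X ≤ u Y) ∧ 0 ≤ u ∅

/-- An allocation is `α`-EF1. -/
def IsAlphaEF1 {n : ℕ} (u : Fin n → Finset V → ℝ) (A : Fin n → Finset V) (α : ℝ) : Prop :=
  ∀ i j : Fin n, i ≠ j → A j ≠ ∅ → ∃ v ∈ A j, α * u i ((A j).erase v) ≤ u i (A i)

/-- An allocation is EFX (envy-free up to any item). -/
def IsEFX {n : ℕ} (u : Fin n → Finset V → ℝ) (A : Fin n → Finset V) : Prop :=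
  ∀ i j : Fin n, i ≠ j → A j ≠ ∅ → ∀ v ∈ A j, u i ((A j).erase v) ≤ u i (A i)

/-- The number of agents receiving positive utility. -/
noncomputable def nashCount {n : ℕ} (u : Fin n → Finset V → ℝ) (A : Fin n → Finset V) : ℕ :=
  (Finset.univ.filter fun i : Fin n => 0 < u i (A i)).card

/-- The product of the positive utilities. -/
noncomputable def nashProd {n : ℕ} (u : Fin n → Finset V → ℝ) (A : Fin n → Finset V) : ℝ :=
  ∏ i ∈ Finset.univ.filter (fun i : Fin n => 0 < u i (A i)), u i (A i)

/-- A maximum Nash welfare (MNW) connected allocation: maximizes the number of agents with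
positive utility and, subject to that, the product of the positive utilities. -/
def IsMNW (G : SimpleGraph V) {n : ℕ} (u : Fin n → Finset V → ℝ)
    (A : Fin n → Finset V) : Prop :=
  IsConnAlloc G A ∧
  (∀ B : Fin n → Finset V, IsConnAlloc G B → nashCount u B ≤ nashCount u A) ∧
  (∀ B : Fin n → Finset V, IsConnAlloc G B →
    nashCount u B = nashCount u A → nashProd u B ≤ nashProd u A)

/-- `A'` is a Pareto-improvement of `A`. -/
def ParetoImproves {n : ℕ} (u : Fin n → Finset V → ℝ) (A' A : Fin n → Finset V) : Prop :=
  (∀ i, u i (A i) ≤ u i (A' i)) ∧ ∃ j, u j (A j) < u j (A' j)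

/-- A connected allocation is Pareto-optimal if no connected allocation Pareto-improves it. -/
def IsParetoOptimal (G : SimpleGraph V) {n : ℕ} (u : Fin n → Finset V → ℝ)
    (A : Fin n → Finset V) : Prop :=
  ∀ B : Fin n → Finset V, IsConnAlloc G B → ¬ ParetoImproves u B A

/-- The vector of agents' utilities rearranged in increasing order. -/
noncomputable def sortedUtils {n : ℕ} (u : Fin n → Finset V → ℝ)
    (A : Fin n → Finset V) : List ℝ :=
  (((Finset.univ : Finset (Fin n)).val.map fun i => u i (A i)).sort (· ≤ ·))

/-- `A'` is a leximin improvement of `A`: the sorted utility vector of `A'` is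
lexicographically greater than that of `A`. -/
def LeximinImproves {n : ℕ} (u : Fin n → Finset V → ℝ) (A' A : Fin n → Finset V) : Prop :=
  List.Lex (· < ·) (sortedUtils u A) (sortedUtils u A')

/-- A connected leximin allocation. -/
def IsLeximin (G : SimpleGraph V) {n : ℕ} (u : Fin n → Finset V → ℝ)
    (A : Fin n → Finset V) : Prop :=
  IsConnAlloc G A ∧ ∀ B : Fin n → Finset V, IsConnAlloc G B → ¬ LeximinImproves u B A

/-- `G` is a star: there is a central vertex adjacent to exactly all other vertices. -/
def IsStar (G : SimpleGraph V) : Prop :=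
  ∃ c : V, ∀ a b : V, G.Adj a b ↔ a ≠ b ∧ (a = c ∨ b = c)

/-- A submodular utility function. -/
def SubmodularUtil (u : Finset V → ℝ) : Prop :=
  ∀ X Y : Finset V, u (X ∪ Y) + u (X ∩ Y) ≤ u X + u Y

/-- A utility function with binary marginal gains (and `u ∅ = 0`). -/
def BinaryMarginalGains (u : Finset V → ℝ) : Prop :=
  u ∅ = 0 ∧ ∀ (X : Finset V) (v : V),
    u (insert v X) - u X = 0 ∨ u (insert v X) - u X = 1

/-- On the path with `m` vertices (edges numbered `1, …, m-1` from left to right),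
`itv m x y` is the bundle `[x, y]` of all vertices between positions `x` and `y`. -/
def itv (m x y : ℕ) : Finset (Fin m) :=
  Finset.univ.filter fun v : Fin m => x ≤ v.val ∧ v.val < y

end GraphFair

namespace GraphFair

def okL (P : ℕ → ℝ) (a b c : ℕ) : Prop :=
  ∀ z, min (P z - P a) (P c - P z) ≤ P b - P a

def okR (P : ℕ → ℝ) (a b c : ℕ) : Prop :=
  ∀ z, min (P z - P a) (P c - P z) ≤ P c - P b

lemma lt_of_P {P : ℕ → ℝ} (hP : Monotone P) {a b : ℕ} (h : P a < P b) : a < b :=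
  hP.reflect_lt h

lemma not_okL {P : ℕ → ℝ} {a b c : ℕ} (h : ¬ okL P a b c) :
    ∃ z, P b < P z ∧ P b - P a < P c - P z := by
  unfold okL at h
  push Not at h
  obtain ⟨z, hz⟩ := h
  rw [lt_min_iff] at hz
  exact ⟨z, by linarith [hz.1], hz.2⟩

lemma not_okR {P : ℕ → ℝ} {a b c : ℕ} (h : ¬ okR P a b c) :
    ∃ z, P z < P b ∧ P c - P b < P z - P a := by
  unfold okR at h
  push Not at h
  obtain ⟨z, hz⟩ := h
  rw [lt_min_iff] at hz
  exact ⟨z, by linarith [hz.2], hz.1⟩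

lemma okL_of_le {P : ℕ → ℝ} {a b c : ℕ} (h : P c - P b ≤ P b - P a) : okL P a b c := by
  by_contra hn
  obtain ⟨z, h1, h2⟩ := not_okL hn
  linarith

lemma okR_of_le {P : ℕ → ℝ} {a b c : ℕ} (h : P b - P a ≤ P c - P b) : okR P a b c := by
  by_contra hn
  obtain ⟨z, h1, h2⟩ := not_okR hn
  linarith

lemma okL_mono {P : ℕ → ℝ} (hP : Monotone P) {a b c b' c' : ℕ} (hb : b ≤ b') (hc : c' ≤ c)
    (h : okL P a b c) : okL P a b' c' := by
  by_contra hn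
  obtain ⟨z, h1, h2⟩ := not_okL hn
  have := hP hb
  have := hP hc
  have := h z
  rw [min_le_iff] at this
  rcases this with h | h <;> linarith

lemma okR_mono {P : ℕ → ℝ} (hP : Monotone P) {a b c b' a' : ℕ} (hb : b' ≤ b) (ha : a ≤ a')
    (h : okR P a b c) : okR P a' b' c := by
  by_contra hn
  obtain ⟨z, h1, h2⟩ := not_okR hn
  have := hP hb
  have := hP ha
  have := h z
  rw [min_le_iff] at this
  rcases this with h | h <;> linarith

/-- enlarging the left piece on its left. -/
lemma okL_grow {P : ℕ → ℝ} (hP : Monotone P) {a b c a' : ℕ} (ha : a' ≤ a)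
    (h : okL P a b c) : okL P a' b c := by
  by_contra hn
  obtain ⟨z, h1, h2⟩ := not_okL hn
  have := hP ha
  have := h z
  rw [min_le_iff] at this
  rcases this with h | h <;> linarith

lemma okR_grow {P : ℕ → ℝ} (hP : Monotone P) {a b c c' : ℕ} (hc : c ≤ c')
    (h : okR P a b c) : okR P a b c' := by
  by_contra hn
  obtain ⟨z, h1, h2⟩ := not_okR hn
  have := hP hc
  have := h z
  rw [min_le_iff] at this
  rcases this with h | h <;> linarith

/-- right piece not ok: we can move the cut left, and the left piece remains ok. -/
lemma step_left {P : ℕ → ℝ} (hP : Monotone P) {a b c : ℕ} (hbc : b ≤ c) (h : ¬ okR P a b c) :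
    a + 1 < b ∧ okL P a (b - 1) c := by
  obtain ⟨z, h1, h2⟩ := not_okR h
  have h3 := lt_of_P hP h1
  have h4 := hP hbc
  have h5 : a < z := lt_of_P hP (by linarith)
  refine ⟨by omega, ?_⟩
  by_contra hn
  obtain ⟨w, h6, h7⟩ := not_okL hn
  have h8 := lt_of_P hP h6
  have h9 : P b ≤ P w := hP (by omega)
  have h10 : P z ≤ P (b-1) := hP (by omega)
  linarith

lemma step_right {P : ℕ → ℝ} (hP : Monotone P) {a b c : ℕ} (hab : a ≤ b) (h : ¬ okL P a b c) :
    b + 1 < c ∧ okR P a (b + 1) c := by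
  obtain ⟨z, h1, h2⟩ := not_okL h
  have h3 := lt_of_P hP h1
  have h4 := hP hab
  have h5 : z < c := lt_of_P hP (by linarith)
  refine ⟨by omega, ?_⟩
  by_contra hn
  obtain ⟨w, h6, h7⟩ := not_okR hn
  have h8 := lt_of_P hP h6
  have h9 : P w ≤ P b := hP (by omega)
  have h10 : P (b+1) ≤ P z := hP (by omega)
  linarith

def Done (p : Fin 3 → ℕ → ℝ) (m : ℕ) : Prop :=
  ∃ a b c : Fin 3, a ≠ b ∧ a ≠ c ∧ b ≠ c ∧ ∃ x y, 0 < x ∧ x < y ∧ y < m ∧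
    okL (p a) 0 x y ∧ okR (p b) 0 x y ∧ okL (p b) x y m ∧ okR (p c) x y m

def mn (P : ℕ → ℝ) (m x y : ℕ) : ℝ := min (P x - P 0) (min (P y - P x) (P m - P y))

/-- process 1 -/
lemma proc1 (p : Fin 3 → ℕ → ℝ) (hp : ∀ i, Monotone (p i)) (m x0 y0 : ℕ)
    (hmax : ∀ x y, 0 < x → x < y → y < m → mn (p 0) m x y ≤ mn (p 0) m x0 y0)
    (hM0 : okR (p 0) 0 x0 y0) (x : ℕ) : ∀ y, 0 < x → x < y → y < m → x ≤ x0 →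
    okL (p 0) x y m → okR (p 0) x y m →
    (y = y0 ∨ min (p 0 y0 - p 0 x0) (p 0 m - p 0 y0) < min (p 0 y - p 0 x) (p 0 m - p 0 y)) →
    okL (p 1) 0 x y → okL (p 2) 0 x y → Done p m := by
  induction x with
  | zero => intro y h; omega
  | succ x ih =>
    intro y hx hxy hym hx0 hL hR hJ h1 h2
    have hM : okR (p 0) 0 (x+1) y := by
      rcases hJ with rfl | hJ
      · exact okR_mono (hp 0) hx0 le_rfl hM0
      · by_contra hn
        obtain ⟨z, hz1, hz2⟩ := not_okR hn
        have a1 := hp 0 hxy.le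
        have a2 := hp 0 hym.le
        have a3 := lt_of_P (hp 0) hz1
        have a4 : 0 < z := lt_of_P (hp 0) (by linarith)
        have a5 := hmax z y a4 (by omega) hym
        have a6 : mn (p 0) m x0 y0 ≤ min (p 0 y0 - p 0 x0) (p 0 m - p 0 y0) := min_le_right _ _
        have a7 : min (p 0 y - p 0 (x+1)) (p 0 m - p 0 y) ≤ mn (p 0) m z y := by
          unfold mn
          refine le_min ?_ (le_min ?_ (min_le_right _ _))
          · exact (min_le_left _ _).trans hz2.le
          · exact (min_le_left _ _).trans (by linarith)
        linarith
    by_cases m1 : okR (p 1) 0 (x+1) y ∧ okL (p 1) (x+1) y m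
    · exact ⟨2, 1, 0, by decide, by decide, by decide, x+1, y, hx, hxy, hym, h2, m1.1, m1.2, hR⟩
    by_cases m2 : okR (p 2) 0 (x+1) y ∧ okL (p 2) (x+1) y m
    · exact ⟨1, 2, 0, by decide, by decide, by decide, x+1, y, hx, hxy, hym, h1, m2.1, m2.2, hR⟩
    by_cases r1 : okR (p 1) (x+1) y m
    · exact ⟨2, 0, 1, by decide, by decide, by decide, x+1, y, hx, hxy, hym, h2, hM, hL, r1⟩
    by_cases r2 : okR (p 2) (x+1) y m
    · exact ⟨1, 0, 2, by decide, by decide, by decide, x+1, y, hx, hxy, hym, h1, hM, hL, r2⟩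
    have key : ∀ i, ¬ (okR (p i) 0 (x+1) y ∧ okL (p i) (x+1) y m) → ¬ okR (p i) (x+1) y m →
        0 + 1 < x + 1 ∧ okL (p i) 0 x y := by
      intro i hi hr
      have : okL (p i) (x+1) y m := by
        rcases le_total (p i m - p i y) (p i y - p i (x+1)) with h | h
        · exact okL_of_le h
        · exact absurd (okR_of_le h) hr
      exact step_left (hp i) hxy.le (fun h => hi ⟨h, this⟩)
    obtain ⟨hx1, k1⟩ := key 1 m1 r1
    obtain ⟨-, k2⟩ := key 2 m2 r2
    have hL' : okL (p 0) x y m := okL_grow (hp 0) (by omega) hL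
    have hxx : p 0 x ≤ p 0 (x+1) := hp 0 (by omega)
    by_cases hR' : okR (p 0) x y m
    · refine ih y (by omega) (by omega) hym (by omega) hL' hR' ?_ k1 k2
      rcases hJ with h | h
      · exact Or.inl h
      · exact Or.inr (h.trans_le (min_le_min_right _ (by linarith)))
    · obtain ⟨z, hz1, hz2⟩ := not_okR hR'
      have hzy := lt_of_P (hp 0) hz1
      have hym' := hp 0 hym.le
      have hxz : x < z := lt_of_P (hp 0) (by linarith)
      obtain ⟨w, hw, hwmax⟩ := Finset.exists_max_image (Finset.Icc x m)
        (fun w => min (p 0 w - p 0 x) (p 0 m - p 0 w)) ⟨z, Finset.mem_Icc.2 ⟨by omega, by omega⟩⟩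
      have hwz := hwmax z (Finset.mem_Icc.2 ⟨by omega, by omega⟩)
      have hbig : p 0 m - p 0 y < min (p 0 w - p 0 x) (p 0 m - p 0 w) :=
        lt_of_lt_of_le (lt_min hz2 (by linarith)) hwz
      obtain ⟨hb1, hb2⟩ := lt_min_iff.1 hbig
      have hwy : w < y := lt_of_P (hp 0) (by linarith)
      have hxw : x < w := lt_of_P (hp 0) (by linarith)
      have hall : ∀ z, min (p 0 z - p 0 x) (p 0 m - p 0 z) ≤
          min (p 0 w - p 0 x) (p 0 m - p 0 w) := by
        intro v
        by_cases hv : v ∈ Finset.Icc x m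
        · exact hwmax v hv
        · rw [Finset.mem_Icc] at hv
          rcases lt_or_ge v x with h | h
          · have := hp 0 h.le
            exact (min_le_left _ _).trans (by linarith)
          · have : p 0 m ≤ p 0 v := hp 0 (by omega)
            exact (min_le_right _ _).trans (by linarith)
      refine ih w (by omega) hxw (by omega) (by omega) (fun v => (hall v).trans (min_le_left _ _))
        (fun v => (hall v).trans (min_le_right _ _)) (Or.inr ?_)
        (okL_mono (hp 1) le_rfl hwy.le k1) (okL_mono (hp 2) le_rfl hwy.le k2)
      have : min (p 0 y - p 0 (x+1)) (p 0 m - p 0 y) ≤ p 0 m - p 0 y := min_le_right _ _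
      rcases hJ with rfl | h
      · exact lt_of_le_of_lt (min_le_right _ _) hbig
      · linarith

/-- process 2 -/
lemma proc2 (p : Fin 3 → ℕ → ℝ) (hp : ∀ i, Monotone (p i)) (m : ℕ) (d : ℕ) :
    ∀ x y, y - x ≤ d → 0 < x → x < y → y < m →
    okL (p 0) 0 x y → okR (p 0) x y m →
    ¬ okL (p 1) 0 x y → ¬ okR (p 1) x y m → ¬ okL (p 2) 0 x y → ¬ okR (p 2) x y m →
    Done p m := by
  induction d with
  | zero => intro x y; omega
  | succ d ih =>
    intro x y hd hx hxy hym hL hR l1 r1 l2 r2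
    obtain ⟨hx1, l1'⟩ := step_right (hp 1) (Nat.zero_le _) l1
    obtain ⟨-, l2'⟩ := step_right (hp 2) (Nat.zero_le _) l2
    obtain ⟨-, r1'⟩ := step_left (hp 1) hym.le r1
    obtain ⟨-, r2'⟩ := step_left (hp 2) hym.le r2
    have fin : ∀ X Y, Y - X ≤ d → 0 < X → X < Y → Y < m → okL (p 0) 0 X Y → okR (p 0) X Y m →
        okR (p 1) 0 X Y → okL (p 1) X Y m → (¬ okL (p 2) 0 X Y → ¬ okR (p 2) X Y m → 
          okR (p 2) 0 X Y ∧ okL (p 2) X Y m) → Done p m := by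
      intro X Y hd hX hXY hYm hL hR a1 a2 a3
      by_cases l2 : okL (p 2) 0 X Y
      · exact ⟨2, 1, 0, by decide, by decide, by decide, X, Y, hX, hXY, hYm, l2, a1, a2, hR⟩
      by_cases r2 : okR (p 2) X Y m
      · exact ⟨0, 1, 2, by decide, by decide, by decide, X, Y, hX, hXY, hYm, hL, a1, a2, r2⟩
      obtain ⟨b1, b2⟩ := a3 l2 r2
      by_cases l1 : okL (p 1) 0 X Y
      · exact ⟨1, 2, 0, by decide, by decide, by decide, X, Y, hX, hXY, hYm, l1, b1, b2, hR⟩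
      by_cases r1 : okR (p 1) X Y m
      · exact ⟨0, 2, 1, by decide, by decide, by decide, X, Y, hX, hXY, hYm, hL, b1, b2, r1⟩
      exact ih X Y hd hX hXY hYm hL hR l1 r1 l2 r2
    by_cases c1 : okL (p 1) (x+1) y m
    · refine fin (x+1) y (by omega) (by omega) hx1 hym (okL_mono (hp 0) (by omega) le_rfl hL)
        (okR_mono (hp 0) le_rfl (by omega) hR) l1' c1 ?_
      intro _ h
      refine ⟨l2', ?_⟩
      by_contra hn
      apply h
      apply okR_of_le
      by_contra h'
      exact hn (okL_of_le (by linarith))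
    by_cases c2 : okR (p 1) 0 x (y-1)
    · refine fin x (y-1) (by omega) (by omega) (by omega) (by omega)
        (okL_mono (hp 0) le_rfl (by omega) hL)
        (okR_mono (hp 0) (by omega) le_rfl hR) c2 r1' ?_
      intro h _
      refine ⟨?_, r2'⟩
      by_contra hn
      apply h
      apply okL_of_le
      by_contra h'
      exact hn (okR_of_le (by linarith))
    exfalso
    have e1 : p 1 y - p 1 (x+1) < p 1 m - p 1 y := by
      by_contra h
      exact c1 (okL_of_le (by linarith))
    have e2 : p 1 (y-1) - p 1 x < p 1 x - p 1 0 := by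
      by_contra h
      exact c2 (okR_of_le (by linarith))
    obtain ⟨z, hz1, hz2⟩ := not_okL l1
    obtain ⟨w, hw1, hw2⟩ := not_okR r1
    have hz3 : p 1 (x+1) ≤ p 1 z := hp 1 (lt_of_P (hp 1) hz1)
    have hw3 : p 1 w ≤ p 1 (y-1) := hp 1 (by have := lt_of_P (hp 1) hw1; omega)
    linarith

def refl3 (p : Fin 3 → ℕ → ℝ) (m : ℕ) : Fin 3 → ℕ → ℝ := fun i k => p i m - p i (m - k)

lemma refl3_mono {p : Fin 3 → ℕ → ℝ} (hp : ∀ i, Monotone (p i)) (m : ℕ) (i) :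
    Monotone (refl3 p m i) := by
  intro a b h
  have : p i (m - b) ≤ p i (m - a) := hp i (by omega)
  simp only [refl3]; linarith

lemma okL_refl {p : Fin 3 → ℕ → ℝ} (hp : ∀ i, Monotone (p i)) {m a b c : ℕ} (hab : a ≤ b)
    (i : Fin 3) (h : okL (refl3 p m i) a b c) : okR (p i) (m - c) (m - b) (m - a) := by
  unfold okL refl3 at h
  intro z
  rcases le_total z m with hz | hz
  · have := h (m - z)
    rw [Nat.sub_sub_self hz] at this
    rw [min_le_iff] at this ⊢
    rcases this with h | h
    · right; linarith
    · left; linarith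
  · have h1 := hp i hz
    have h2 := hp i (Nat.sub_le m a)
    have h3 : p i (m - b) ≤ p i (m - a) := hp i (by omega)
    exact (min_le_right _ _).trans (by linarith)

lemma okR_refl {p : Fin 3 → ℕ → ℝ} (hp : ∀ i, Monotone (p i)) {m a b c : ℕ} (hbc : b ≤ c)
    (i : Fin 3) (h : okR (refl3 p m i) a b c) : okL (p i) (m - c) (m - b) (m - a) := by
  unfold okR refl3 at h
  intro z
  rcases le_total z m with hz | hz
  · have := h (m - z)
    rw [Nat.sub_sub_self hz] at this
    rw [min_le_iff] at this ⊢
    rcases this with h | h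
    · right; linarith
    · left; linarith
  · have h1 := hp i hz
    have h2 := hp i (Nat.sub_le m a)
    have h3 : p i (m - c) ≤ p i (m - b) := hp i (by omega)
    exact (min_le_right _ _).trans (by linarith)

lemma okL_refl' {p : Fin 3 → ℕ → ℝ} {m a b c : ℕ} (ha : a ≤ m) (hb : b ≤ m) (hc : c ≤ m)
    (i : Fin 3) (h : okL (p i) a b c) : okR (refl3 p m i) (m - c) (m - b) (m - a) := by
  unfold okR refl3
  intro z
  have := h (m - z)
  rw [Nat.sub_sub_self ha, Nat.sub_sub_self hb, Nat.sub_sub_self hc]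
  rw [min_le_iff] at this ⊢
  rcases this with h | h
  · right; linarith
  · left; linarith

lemma okR_refl' {p : Fin 3 → ℕ → ℝ} {m a b c : ℕ} (ha : a ≤ m) (hb : b ≤ m) (hc : c ≤ m)
    (i : Fin 3) (h : okR (p i) a b c) : okL (refl3 p m i) (m - c) (m - b) (m - a) := by
  unfold okL refl3
  intro z
  have := h (m - z)
  rw [Nat.sub_sub_self ha, Nat.sub_sub_self hb, Nat.sub_sub_self hc]
  rw [min_le_iff] at this ⊢
  rcases this with h | h
  · right; linarith
  · left; linarith

lemma done_refl {p : Fin 3 → ℕ → ℝ} (hp : ∀ i, Monotone (p i)) {m : ℕ}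
    (h : Done (refl3 p m) m) : Done p m := by
  obtain ⟨a, b, c, hab, hac, hbc, x, y, hx, hxy, hym, h1, h2, h3, h4⟩ := h
  refine ⟨c, b, a, hbc.symm, hac.symm, hab.symm, m - y, m - x, by omega, by omega, by omega,
    ?_, ?_, ?_, ?_⟩
  · simpa using okR_refl hp hym.le _ h4
  · simpa using okL_refl hp hxy.le _ h3
  · simpa using okR_refl hp hxy.le _ h2
  · simpa using okL_refl hp hx.le _ h1

/-- the cutter's initial partition -/
lemma cutter (P : ℕ → ℝ) (hP : Monotone P) (m : ℕ) (hm : 3 ≤ m) :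
    ∃ x y, 0 < x ∧ x < y ∧ y < m ∧ okL P 0 x y ∧ okR P 0 x y ∧ okL P x y m ∧ okR P x y m ∧
      ∀ x' y', 0 < x' → x' < y' → y' < m → mn P m x' y' ≤ mn P m x y := by
  classical
  let S : Finset (ℕ × ℕ) := (Finset.range m ×ˢ Finset.range m).filter
    (fun q => 0 < q.1 ∧ q.1 < q.2 ∧ q.2 < m)
  have hS : ∀ q : ℕ × ℕ, q ∈ S ↔ 0 < q.1 ∧ q.1 < q.2 ∧ q.2 < m := by
    intro q
    simp only [S, Finset.mem_filter, Finset.mem_product, Finset.mem_range]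
    omega
  obtain ⟨q, hq, hqmax⟩ := Finset.exists_max_image S (fun q => mn P m q.1 q.2)
    ⟨(1, 2), (hS _).2 ⟨by simp, by simp, by simp; omega⟩⟩
  obtain ⟨r, hr, hrmin⟩ := Finset.exists_min_image
    (S.filter (fun r => mn P m q.1 q.2 ≤ mn P m r.1 r.2))
    (fun r => (P r.1 - P 0) ^ 2 + (P r.2 - P r.1) ^ 2 + (P m - P r.2) ^ 2)
    ⟨q, Finset.mem_filter.2 ⟨hq, le_rfl⟩⟩
  obtain ⟨hrS, hrq⟩ := Finset.mem_filter.1 hr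
  obtain ⟨x, y⟩ := r
  obtain ⟨hx, hxy, hym⟩ := (hS _).1 hrS
  simp only at hx hxy hym hrq
  have key : ∀ x' y', 0 < x' → x' < y' → y' < m → mn P m x y ≤ mn P m x' y' →
      (P x - P 0) ^ 2 + (P y - P x) ^ 2 + (P m - P y) ^ 2 ≤
      (P x' - P 0) ^ 2 + (P y' - P x') ^ 2 + (P m - P y') ^ 2 := by
    intro x' y' h1 h2 h3 h4
    exact hrmin (x', y') (Finset.mem_filter.2 ⟨(hS _).2 ⟨h1, h2, h3⟩, hrq.trans h4⟩)
  have m1 := hP (Nat.zero_le x)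
  have m2 := hP hxy.le
  have m3 := hP hym.le
  refine ⟨x, y, hx, hxy, hym, ?_, ?_, ?_, ?_, fun x' y' h1 h2 h3 =>
    (hqmax (x', y') ((hS _).2 ⟨h1, h2, h3⟩)).trans hrq⟩
  · by_contra hn
    obtain ⟨z, h1, h2⟩ := not_okL hn
    have a1 := lt_of_P hP h1
    have a2 : z < y := lt_of_P hP (by linarith)
    have := key z y (by omega) a2 hym (by
      unfold mn
      refine le_min ((min_le_left _ _).trans (by linarith)) (le_min ((min_le_left _ _).trans h2.le) ?_)
      exact (min_le_right _ _).trans (min_le_right _ _))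
    nlinarith [mul_pos (sub_pos.2 h1) (sub_pos.2 h2)]
  · by_contra hn
    obtain ⟨z, h1, h2⟩ := not_okR hn
    have a1 := lt_of_P hP h1
    have a2 : 0 < z := lt_of_P hP (by linarith)
    have := key z y a2 (by omega) hym (by
      unfold mn
      refine le_min (((min_le_right _ _).trans (min_le_left _ _)).trans h2.le)
        (le_min (((min_le_right _ _).trans (min_le_left _ _)).trans (by linarith)) ?_)
      exact (min_le_right _ _).trans (min_le_right _ _))
    nlinarith [mul_pos (sub_pos.2 h1) (sub_pos.2 h2)]
  · by_contra hn
    obtain ⟨z, h1, h2⟩ := not_okL hn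
    have a1 := lt_of_P hP h1
    have a2 : z < m := lt_of_P hP (by linarith)
    have := key x z hx (by omega) a2 (by
      unfold mn
      refine le_min (min_le_left _ _)
        (le_min (((min_le_right _ _).trans (min_le_left _ _)).trans (by linarith)) ?_)
      exact ((min_le_right _ _).trans (min_le_left _ _)).trans h2.le)
    nlinarith [mul_pos (sub_pos.2 h1) (sub_pos.2 h2)]
  · by_contra hn
    obtain ⟨z, h1, h2⟩ := not_okR hn
    have a1 := lt_of_P hP h1
    have a2 : x < z := lt_of_P hP (by linarith)
    have := key x z hx a2 (by omega) (by
      unfold mn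
      refine le_min (min_le_left _ _)
        (le_min (((min_le_right _ _).trans (min_le_right _ _)).trans h2.le) ?_)
      exact ((min_le_right _ _).trans (min_le_right _ _)).trans (by linarith))
    nlinarith [mul_pos (sub_pos.2 h1) (sub_pos.2 h2)]

lemma mn_refl (p : Fin 3 → ℕ → ℝ) {m x y : ℕ} (hx : x ≤ m) (hy : y ≤ m) :
    mn (refl3 p m 0) m (m - y) (m - x) = mn (p 0) m x y := by
  unfold mn refl3
  rw [Nat.sub_sub_self hx, Nat.sub_sub_self hy]
  simp only [Nat.sub_zero, Nat.sub_self, sub_sub_sub_cancel_left, sub_self, sub_zero]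
  rw [min_comm, min_assoc, min_comm, min_comm (p 0 y - p 0 x), ← min_assoc]

lemma core (p : Fin 3 → ℕ → ℝ) (hp : ∀ i, Monotone (p i)) (m : ℕ) (hm : 3 ≤ m) : Done p m := by
  obtain ⟨x, y, hx, hxy, hym, c1, c2, c3, c4, hmax⟩ := cutter (p 0) (hp 0) m hm
  by_cases hl : okL (p 1) 0 x y ∧ okL (p 2) 0 x y
  · exact proc1 p hp m x y hmax c2 x y hx hxy hym le_rfl c3 c4 (Or.inl rfl) hl.1 hl.2
  by_cases hr : okR (p 1) x y m ∧ okR (p 2) x y m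
  · apply done_refl hp
    refine proc1 (refl3 p m) (refl3_mono hp m) m (m - y) (m - x) ?_ ?_ (m - y) (m - x)
      (by omega) (by omega) (by omega) le_rfl ?_ ?_ (Or.inl rfl) ?_ ?_
    · intro x' y' h1 h2 h3
      rw [mn_refl p (by omega) hym.le]
      have := hmax (m - y') (m - x') (by omega) (by omega) (by omega)
      rw [← mn_refl p (by omega) (by omega), Nat.sub_sub_self (by omega),
        Nat.sub_sub_self (by omega)] at this
      exact this
    · simpa using okL_refl' (p := p) (by omega) hym.le le_rfl 0 c3
    · simpa using okR_refl' (p := p) (m := m) (by omega) (by omega) (by omega) 0 c2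
    · simpa using okL_refl' (p := p) (m := m) (by omega) (by omega) (by omega) 0 c1
    · simpa using okR_refl' (p := p) (m := m) (by omega) (by omega) (by omega) 1 hr.1
    · simpa using okR_refl' (p := p) (m := m) (by omega) (by omega) (by omega) 2 hr.2
  have ex : ∀ i, okL (p i) 0 x y ∨ (okR (p i) 0 x y ∧ okL (p i) x y m) ∨ okR (p i) x y m := by
    intro i
    by_contra hn
    push Not at hn
    obtain ⟨n1, n2, n3⟩ := hn
    have d1 : p i x - p i 0 < p i y - p i x := by
      by_contra h
      exact n1 (okL_of_le (by linarith))
    have d3 : p i m - p i y < p i y - p i x := by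
      by_contra h
      exact n3 (okR_of_le (by linarith))
    obtain ⟨z, h1, h2⟩ := not_okL (n2 (by
      by_contra h
      obtain ⟨z, h1, h2⟩ := not_okR h
      obtain ⟨w, h3, h4⟩ := not_okL n1
      linarith))
    obtain ⟨w, h3, h4⟩ := not_okR n3
    linarith
  have D : ∀ a b c : Fin 3, a ≠ b → a ≠ c → b ≠ c → 
    okL (p a) 0 x y → (okR (p b) 0 x y ∧ okL (p b) x y m) → okR (p c) x y m → Done p m :=
    fun a b c h1 h2 h3 h4 h5 h6 => ⟨a, b, c, h1, h2, h3, x, y, hx, hxy, hym, h4, h5.1, h5.2, h6⟩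
  have D102 := D 1 0 2 (by decide) (by decide) (by decide)
  have D120 := D 1 2 0 (by decide) (by decide) (by decide)
  have D201 := D 2 0 1 (by decide) (by decide) (by decide)
  have D210 := D 2 1 0 (by decide) (by decide) (by decide)
  have D012 := D 0 1 2 (by decide) (by decide) (by decide)
  have D021 := D 0 2 1 (by decide) (by decide) (by decide)
  by_cases l1 : okL (p 1) 0 x y
  · have l2 : ¬ okL (p 2) 0 x y := fun h => hl ⟨l1, h⟩
    rcases ex 2 with h | h | h
    · exact absurd h l2
    · exact D120 l1 h c4
    · exact D102 l1 ⟨c2, c3⟩ h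
  by_cases r1 : okR (p 1) x y m
  · have r2 : ¬ okR (p 2) x y m := fun h => hr ⟨r1, h⟩
    rcases ex 2 with h | h | h
    · exact D201 h ⟨c2, c3⟩ r1
    · exact D021 c1 h r1
    · exact absurd h r2
  have m1 : okR (p 1) 0 x y ∧ okL (p 1) x y m := by
    rcases ex 1 with h | h | h
    · exact absurd h l1
    · exact h
    · exact absurd h r1
  by_cases l2 : okL (p 2) 0 x y
  · exact D210 l2 m1 c4
  by_cases r2 : okR (p 2) x y m
  · exact D012 c1 m1 r2
  exact proc2 p hp m (y - x) x y le_rfl hx hxy hym c1 c4 l1 r1 l2 r2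

end GraphFair

namespace GraphFair

lemma util_mono {m : ℕ} {u : Finset (Fin m) → ℝ} (hu : AdditiveUtil u) {X Y : Finset (Fin m)}
    (h : X ⊆ Y) : u X ≤ u Y := by
  rw [hu.1 X, hu.1 Y]
  exact Finset.sum_le_sum_of_subset_of_nonneg h (fun v _ _ => hu.2 v)

lemma util_empty {m : ℕ} {u : Finset (Fin m) → ℝ} (hu : AdditiveUtil u) : u ∅ = 0 := by
  rw [hu.1 ∅]; simp

lemma util_nonneg {m : ℕ} {u : Finset (Fin m) → ℝ} (hu : AdditiveUtil u) (X : Finset (Fin m)) :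
    0 ≤ u X := by
  rw [hu.1 X]; exact Finset.sum_nonneg (fun v _ => hu.2 v)

lemma mem_itv {m x y : ℕ} {v : Fin m} : v ∈ itv m x y ↔ x ≤ v.val ∧ v.val < y := by
  simp [itv]

lemma util_itv {m : ℕ} {u : Finset (Fin m) → ℝ} (hu : AdditiveUtil u) {a b : ℕ} (h : a ≤ b) :
    u (itv m a b) = u (itv m 0 b) - u (itv m 0 a) := by
  have h1 : itv m 0 b = itv m 0 a ∪ itv m a b := by
    ext v; simp only [Finset.mem_union, mem_itv]; omega
  have h2 : Disjoint (itv m 0 a) (itv m a b) := by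
    rw [Finset.disjoint_left]; intro v; simp only [mem_itv]; omega
  rw [h1, hu.1 (_ ∪ _), Finset.sum_union h2, ← hu.1, ← hu.1]; ring

lemma conn_itv {m a b : ℕ} (hab : a < b) (hb : b ≤ m) :
    BundleConn (SimpleGraph.pathGraph m) (itv m a b) := by
  right
  have h0 : (⟨a, by omega⟩ : Fin m) ∈ (itv m a b : Set (Fin m)) := by
    simp only [Finset.mem_coe, mem_itv]; omega
  have key : ∀ k (hk : a + k < b), ((SimpleGraph.pathGraph m).induce (itv m a b : Set (Fin m))).Reachable
      ⟨⟨a, by omega⟩, h0⟩ ⟨⟨a + k, by omega⟩, by simp only [Finset.mem_coe, mem_itv]; omega⟩ := by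
    intro k
    induction k with
    | zero => intro hk; exact SimpleGraph.Reachable.refl _
    | succ k ih =>
      intro hk
      refine (ih (by omega)).trans (SimpleGraph.Adj.reachable ?_)
      simp only [SimpleGraph.comap_adj, SimpleGraph.pathGraph_adj, Function.Embedding.subtype_apply]
      left; omega
  haveI : Nonempty ((itv m a b : Set (Fin m))) := ⟨⟨_, h0⟩⟩
  refine ⟨?_⟩
  have key' : ∀ v, ((SimpleGraph.pathGraph m).induce (itv m a b : Set (Fin m))).Reachable
      ⟨⟨a, by omega⟩, h0⟩ v := by
    rintro ⟨⟨v, hv⟩, hv'⟩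
    have hh := hv'
    simp only [Finset.mem_coe, mem_itv] at hh
    obtain ⟨k, rfl⟩ := Nat.exists_eq_add_of_le hh.1
    exact key k hh.2
  intro v w
  exact (key' v).symm.trans (key' w)

lemma conn_convex {m : ℕ} {B : Finset (Fin m)} (h : BundleConn (SimpleGraph.pathGraph m) B)
    {x y z : Fin m} (hx : x ∈ B) (hy : y ∈ B) (hxz : x ≤ z) (hzy : z ≤ y) : z ∈ B := by
  rcases h with rfl | h
  · simp at hx
  by_contra hz
  have hr := h.preconnected ⟨x, hx⟩ ⟨y, hy⟩
  obtain ⟨w⟩ := hr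
  have key : ∀ (s t : (B : Set (Fin m))),
      ((SimpleGraph.pathGraph m).induce (B : Set (Fin m))).Walk s t → s.1 ≤ z → t.1 ≤ z := by
    intro s t w
    induction w with
    | nil => exact id
    | @cons s t r hst _ ih =>
      intro hs
      apply ih
      simp only [SimpleGraph.comap_adj, SimpleGraph.pathGraph_adj,
        Function.Embedding.subtype_apply] at hst
      have : s.1 ≠ z := fun h => hz (h ▸ s.2)
      have h2 : s.1.val ≠ z.val := fun h => this (Fin.ext h)
      rw [Fin.le_def] at hs ⊢
      omega
  have h1 := key _ _ w hxz
  have : y = z := le_antisymm h1 hzy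
  exact hz (this ▸ hy)

lemma cut_aux {m a c : ℕ} (hc : c ≤ m) {X Y : Finset (Fin m)}
    (hU : X ∪ Y = itv m a c) (hD : Disjoint X Y) (hX : BundleConn (SimpleGraph.pathGraph m) X)
    (ha : ∃ v ∈ X, v.val = a) : ∃ z, a ≤ z ∧ z ≤ c ∧ X = itv m a z ∧ Y = itv m z c := by
  obtain ⟨v, hv, hva⟩ := ha
  have hXs : ∀ w ∈ X, a ≤ w.val ∧ w.val < c := fun w hw =>
    mem_itv.1 (hU ▸ Finset.mem_union_left _ hw)
  have hne : X.Nonempty := ⟨v, hv⟩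
  have hmx := X.max'_mem hne
  have hXe : X = itv m a ((X.max' hne).val + 1) := by
    ext w
    rw [mem_itv]
    constructor
    · intro hw
      have := X.le_max' w hw
      rw [Fin.le_def] at this
      exact ⟨(hXs w hw).1, by omega⟩
    · intro hw
      refine conn_convex hX hv hmx ?_ ?_
      · rw [Fin.le_def]; omega
      · rw [Fin.le_def]; omega
  refine ⟨(X.max' hne).val + 1, ?_, ?_, hXe, ?_⟩
  · have := (hXs _ hmx).1; omega
  · have := (hXs _ hmx).2; omega
  · ext w
    have hb := hXs _ hmx
    have e1 : w ∈ X ↔ a ≤ w.val ∧ w.val < (X.max' hne).val + 1 := by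
      conv_lhs => rw [hXe]
      exact mem_itv
    have e2 : (w ∈ X ∨ w ∈ Y) ↔ a ≤ w.val ∧ w.val < c := by
      rw [← Finset.mem_union, hU, mem_itv]
    have e3 : w ∈ X → w ∉ Y := fun h => Finset.disjoint_left.1 hD h
    rw [mem_itv]
    constructor
    · intro h
      have := e2.1 (Or.inr h)
      have : ¬ (a ≤ w.val ∧ w.val < (X.max' hne).val + 1) := fun hh => e3 (e1.2 hh) h
      omega
    · intro h
      have h1 := e2.2 ⟨by omega, h.2⟩
      rcases h1 with h1 | h1
      · have := e1.1 h1; omega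
      · exact h1

lemma pmms_le {m : ℕ} {u : Finset (Fin m) → ℝ} (hu : AdditiveUtil u) {a c : ℕ} (hac : a < c)
    (hc : c ≤ m) {t : ℝ} (ht : 0 ≤ t)
    (h : ∀ z, min (u (itv m 0 z) - u (itv m 0 a)) (u (itv m 0 c) - u (itv m 0 z)) ≤ t) :
    pmms (SimpleGraph.pathGraph m) u (itv m a c) ≤ t := by
  unfold pmms
  apply Real.sSup_le _ ht
  rintro _ ⟨⟨X, Y⟩, ⟨hU, hD, hX, hY⟩, rfl⟩
  simp only at hU hD hX hY ⊢
  have ha : (⟨a, by omega⟩ : Fin m) ∈ X ∪ Y := by rw [hU, mem_itv]; simp; omega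
  rcases Finset.mem_union.1 ha with ha | ha
  · obtain ⟨z, h1, h2, rfl, rfl⟩ := cut_aux hc hU hD hX ⟨_, ha, rfl⟩
    rw [util_itv hu h1, util_itv hu h2]
    exact h z
  · obtain ⟨z, h1, h2, rfl, rfl⟩ := cut_aux hc (Finset.union_comm X Y ▸ hU) hD.symm hY ⟨_, ha, rfl⟩
    rw [util_itv hu h1, util_itv hu h2, min_comm]
    exact h z

lemma small_case (m : ℕ) (hm : m < 3)
    (u : Fin 3 → Finset (Fin m) → ℝ) (hu : ∀ i, AdditiveUtil (u i)) :
    ∃ A : Fin 3 → Finset (Fin m),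
      IsConnAlloc (SimpleGraph.pathGraph m) A ∧
      IsAlphaPMMS (SimpleGraph.pathGraph m) u A 1 := by
  refine ⟨fun i => itv m i.val (i.val + 1), ⟨?_, ?_, ?_⟩, ?_⟩
  · intro v
    exact ⟨⟨v.val, by omega⟩, by rw [mem_itv]; simp⟩
  · intro i j hij
    have : i.val ≠ j.val := fun h => hij (Fin.ext h)
    rw [Finset.disjoint_left]; intro v; simp only [mem_itv]; omega
  · intro i
    by_cases h : i.val + 1 ≤ m
    · exact conn_itv (by omega) h
    · left
      ext v
      have := v.2
      simp only [mem_itv, Finset.notMem_empty, iff_false]; omega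
  · intro i j hij _
    rw [one_mul]
    unfold pmms
    apply Real.sSup_le _ (util_nonneg (hu i) _)
    rintro _ ⟨⟨X, Y⟩, ⟨hU, hD, hX, hY⟩, rfl⟩
    simp only at hU hD hX hY ⊢
    by_cases h : X ⊆ itv m i.val (i.val + 1)
    · exact (min_le_left _ _).trans (util_mono (hu i) h)
    · refine (min_le_right _ _).trans (util_mono (hu i) ?_)
      intro w hw
      rw [Finset.not_subset] at h
      obtain ⟨v, hv, hv'⟩ := h
      have h1 : v ∈ X ∪ Y := Finset.mem_union_left _ hv
      have h2 : w ∈ X ∪ Y := Finset.mem_union_right _ hw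
      rw [hU] at h1 h2
      rcases Finset.mem_union.1 h2 with h2 | h2
      · exact h2
      · rcases Finset.mem_union.1 h1 with h1 | h1
        · exact absurd h1 hv'
        · rw [mem_itv] at h1 h2
          have : v = w := Fin.ext (by omega)
          subst this
          exact absurd hw (Finset.disjoint_left.1 hD hv)

lemma three_cases {a b c : Fin 3} (hab : a ≠ b) (hac : a ≠ c) (hbc : b ≠ c) (i : Fin 3) :
    i = a ∨ i = b ∨ i = c := by
  omega

end GraphFair

open GraphFair in
/-- For a path graph and three agents with additive utility functions,
there always exists a connected allocation that is PMMS. -/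
theorem exists_pmms_three_agents_path (m : ℕ)
    (u : Fin 3 → Finset (Fin m) → ℝ) (hu : ∀ i, AdditiveUtil (u i)) :
    ∃ A : Fin 3 → Finset (Fin m),
      IsConnAlloc (SimpleGraph.pathGraph m) A ∧
      IsAlphaPMMS (SimpleGraph.pathGraph m) u A 1 := by
  rcases Nat.lt_or_ge m 3 with hm | hm
  · exact small_case m hm u hu
  obtain ⟨a, b, c, hab, hac, hbc, x, y, hx, hxy, hym, h1, h2, h3, h4⟩ :=
    core (fun i k => u i (itv m 0 k)) (fun i k l hkl => util_mono (hu i) (by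
      intro v; simp only [mem_itv]; omega)) m hm
  let A : Fin 3 → Finset (Fin m) := fun i =>
    if i = a then itv m 0 x else if i = b then itv m x y else itv m y m
  have hAa : A a = itv m 0 x := by simp [A]
  have hAb : A b = itv m x y := by simp [A, hab.symm]
  have hAc : A c = itv m y m := by simp [A, hac.symm, hbc.symm]
  have hall : ∀ P : Fin 3 → Prop, P a → P b → P c → ∀ i, P i := by
    intro P ha hb hc i
    rcases three_cases hab hac hbc i with rfl | rfl | rfl <;> assumption
  have hne : ∀ s t, s < t → t ≤ m → itv m s t ≠ ∅ := by
    intro s t hst ht he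
    have : (⟨s, by omega⟩ : Fin m) ∈ itv m s t := by rw [mem_itv]; simp; omega
    rw [he] at this
    simp at this
  have hun : ∀ s t r, s ≤ t → t ≤ r → itv m s t ∪ itv m t r = itv m s r := by
    intro s t r h1 h2
    ext v; simp only [Finset.mem_union, mem_itv]; omega
  have hdis : ∀ s t r q, t ≤ r → Disjoint (itv m s t) (itv m r q) := by
    intro s t r q h
    rw [Finset.disjoint_left]; intro v; simp only [mem_itv]; omega
  have hnadj : ∀ v ∈ itv m 0 x, ∀ w ∈ itv m y m,
      ¬ (SimpleGraph.pathGraph m).Adj v w := by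
    intro v hv w hw hadj
    rw [mem_itv] at hv hw
    rw [SimpleGraph.pathGraph_adj] at hadj
    omega
  refine ⟨A, ⟨?_, ?_, ?_⟩, ?_⟩
  · intro v
    rcases Nat.lt_or_ge v.val x with h | h
    · exact ⟨a, by rw [hAa, mem_itv]; omega⟩
    rcases Nat.lt_or_ge v.val y with h' | h'
    · exact ⟨b, by rw [hAb, mem_itv]; omega⟩
    · exact ⟨c, by rw [hAc, mem_itv]; omega⟩
  · apply hall
    · apply hall
      · intro h; exact absurd rfl h
      · intro _; rw [hAa, hAb]; exact hdis _ _ _ _ le_rfl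
      · intro _; rw [hAa, hAc]; exact hdis _ _ _ _ hxy.le
    · apply hall
      · intro _; rw [hAa, hAb]; exact (hdis _ _ _ _ le_rfl).symm
      · intro h; exact absurd rfl h
      · intro _; rw [hAb, hAc]; exact hdis _ _ _ _ le_rfl
    · apply hall
      · intro _; rw [hAa, hAc]; exact (hdis _ _ _ _ hxy.le).symm
      · intro _; rw [hAb, hAc]; exact (hdis _ _ _ _ le_rfl).symm
      · intro h; exact absurd rfl h
  · apply hall
    · rw [hAa]; exact conn_itv hx (by omega)
    · rw [hAb]; exact conn_itv hxy (by omega)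
    · rw [hAc]; exact conn_itv hym le_rfl
  · have L := fun i => pmms_le (hu i) (a := 0) (c := y) (by omega) hym.le (util_nonneg (hu i) (A i))
    have R := fun i => pmms_le (hu i) (a := x) (c := m) (by omega) le_rfl (util_nonneg (hu i) (A i))
    apply hall
    · apply hall
      · intro h; exact absurd rfl h
      · intro _ _
        rw [one_mul]
        have := L a
        rw [hAa, util_itv (hu a) hx.le] at this
        rw [hAb, hAa, hun _ _ _ hx.le hxy.le, util_itv (hu a) hx.le]
        exact this h1
      · rintro _ (h | ⟨v, hv, w, hw, hadj⟩)
        · exact absurd (hAa ▸ h) (hne _ _ hx (by omega))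
        · rw [hAa] at hv; rw [hAc] at hw; exact absurd hadj (hnadj v hv w hw)
    · apply hall
      · intro _ _
        rw [one_mul]
        have := L b
        rw [hAb, util_itv (hu b) hxy.le] at this
        rw [hAb, hAa, Finset.union_comm, hun _ _ _ hx.le hxy.le, util_itv (hu b) hxy.le]
        exact this h2
      · intro h; exact absurd rfl h
      · intro _ _
        rw [one_mul]
        have := R b
        rw [hAb, util_itv (hu b) hxy.le] at this
        rw [hAb, hAc, hun _ _ _ hxy.le hym.le, util_itv (hu b) hxy.le]
        exact this h3
    · apply hall
      · rintro _ (h | ⟨v, hv, w, hw, hadj⟩)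
        · exact absurd (hAc ▸ h) (hne _ _ hym le_rfl)
        · rw [hAc] at hv; rw [hAa] at hw; exact absurd hadj.symm (hnadj w hw v hv)
      · intro _ _
        rw [one_mul]
        have := R c
        rw [hAc, util_itv (hu c) hym.le] at this
        rw [hAb, hAc, Finset.union_comm, hun _ _ _ hxy.le hym.le, util_itv (hu c) hym.le]
        exact this h4
      · intro h; exact absurd rfl h
end

section
/- For every α∈(0,1], there exist instances consisting of a path graph and three agents with identical additive utilities witnessing that, under connectivity constraints, neither PMMS nor MMS implies the other up to the factor α: (a) an instance with a connected allocation that is MMS but not α-PMMS, and (b) an instance with a connected allocation that is PMMS but not α-MMS. -/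
open GraphFair in
theorem aux_conn_single {V : Type*} (G : SimpleGraph V) (v : V) :
    BundleConn G ({v} : Finset V) := by
  right
  rw [Finset.coe_singleton]
  have : Nonempty ({v} : Set V) := ⟨⟨v, rfl⟩⟩
  refine SimpleGraph.Connected.mk ?_
  intro a b
  have : a = b := Subsingleton.elim a b
  rw [this]

open GraphFair in
theorem aux_conn_pair {V : Type*} [DecidableEq V] (G : SimpleGraph V) (v w : V) (h : G.Adj v w) :
    BundleConn G ({v, w} : Finset V) := by
  right
  rw [Finset.coe_pair]
  exact SimpleGraph.induce_pair_connected_of_adj h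

open GraphFair in
theorem aux_le_pmms {m : ℕ} (G : SimpleGraph (Fin m)) (u : Finset (Fin m) → ℝ) (Y Z : Finset (Fin m))
    (hd : Disjoint Y Z) (hY : BundleConn G Y) (hZ : BundleConn G Z) :
    min (u Y) (u Z) ≤ pmms G u (Y ∪ Z) :=
  le_csSup (Set.toFinite _).bddAbove ⟨(Y, Z), ⟨rfl, hd, hY, hZ⟩, rfl⟩

open GraphFair in
theorem aux_pmms_le {m : ℕ} (G : SimpleGraph (Fin m)) (f : Finset (Fin m) → ℕ) (X : Finset (Fin m))
    (c : ℕ) (h : ∀ Y Z, Y ∪ Z = X → Disjoint Y Z → min (f Y) (f Z) ≤ c) :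
    pmms G (fun X => (f X : ℝ)) X ≤ c := by
  refine Real.sSup_le ?_ (Nat.cast_nonneg _)
  rintro _ ⟨⟨Y, Z⟩, ⟨h1, h2, -, -⟩, rfl⟩
  have := h Y Z h1 h2
  simp only
  exact_mod_cast this

open GraphFair in
theorem aux_b_pm (X : Finset (Fin 4)) (c : ℕ) (A : ℕ)
    (h : ∀ Y Z, Y ∪ Z = X → Disjoint Y Z → min (Y.erase 0).card (Z.erase 0).card ≤ c) (hc : c ≤ A) :
    1 * pmms (SimpleGraph.pathGraph 4) (fun X => (((X.erase 0).card : ℕ) : ℝ)) X ≤ (A : ℝ) := by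
  rw [one_mul]
  exact (aux_pmms_le _ (fun X => (X.erase 0).card) X c h).trans (by exact_mod_cast hc)

open GraphFair in
/-- For every `α ∈ (0, 1]`, there exist path instances with three agents
having identical additive utilities such that (a) some connected allocation is MMS but
not `α`-PMMS, and (b) some connected allocation is PMMS but not `α`-MMS. -/
theorem mms_pmms_incomparable_on_path :
    ∀ α : ℝ, 0 < α → α ≤ 1 →
      (∃ (m : ℕ) (u : Finset (Fin m) → ℝ) (A : Fin 3 → Finset (Fin m)),
        AdditiveUtil u ∧ IsConnAlloc (SimpleGraph.pathGraph m) A ∧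
        IsAlphaMMS (SimpleGraph.pathGraph m) (fun _ => u) A 1 ∧
        ¬ IsAlphaPMMS (SimpleGraph.pathGraph m) (fun _ => u) A α) ∧
      (∃ (m : ℕ) (u : Finset (Fin m) → ℝ) (A : Fin 3 → Finset (Fin m)),
        AdditiveUtil u ∧ IsConnAlloc (SimpleGraph.pathGraph m) A ∧
        IsAlphaPMMS (SimpleGraph.pathGraph m) (fun _ => u) A 1 ∧
        ¬ IsAlphaMMS (SimpleGraph.pathGraph m) (fun _ => u) A α) := by
  intro α h0 _
  constructor
  · refine ⟨2, fun X => (X.card : ℝ), ![{0, 1}, ∅, ∅], ⟨?_, ?_⟩, ⟨?_, ?_, ?_⟩, ?_, ?_⟩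
    · intro X; simp
    · intro v; simp
    · decide
    · decide
    · intro i
      fin_cases i
      · exact aux_conn_pair _ _ _ (by simp [SimpleGraph.pathGraph_adj])
      · exact Or.inl rfl
      · exact Or.inl rfl
    · intro i
      have : mms (SimpleGraph.pathGraph 2) (fun X : Finset (Fin 2) => (X.card : ℝ)) 3 ≤ 0 := by
        refine Real.sSup_le ?_ le_rfl
        rintro _ ⟨B, ⟨-, h2, -⟩, rfl⟩
        obtain ⟨i, hi⟩ : ∃ i, B i = ∅ := by
          by_contra! hne
          choose f hf using hne
          obtain ⟨i, j, hij, he⟩ :=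
            Fintype.exists_ne_map_eq_of_card_lt f (by simp)
          exact Finset.disjoint_left.mp (h2 i j hij) (hf i) (he ▸ hf j)
        refine (ciInf_le (Set.finite_range _).bddBelow i).trans ?_
        simp [hi]
      rw [one_mul]
      exact this.trans (Nat.cast_nonneg _)
    · intro h
      have h1 := h 1 0 (by decide) (Or.inl rfl)
      have h2 := aux_le_pmms (SimpleGraph.pathGraph 2) (fun X => (X.card : ℝ)) {0} {1} (by decide)
        (aux_conn_single _ _) (aux_conn_single _ _)
      have e : (![{0, 1}, ∅, ∅] : Fin 3 → Finset (Fin 2)) 1 ∪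
        (![{0, 1}, ∅, ∅] : Fin 3 → Finset (Fin 2)) 0 = {0} ∪ {1} := by decide
      rw [e] at h1
      have h3 : α * 1 ≤ 0 := by
        refine le_trans (mul_le_mul_of_nonneg_left ?_ h0.le) (h1.trans (by simp))
        simpa using h2
      linarith
  · refine ⟨4, fun X => ((X.erase 0).card : ℝ), ![{0}, {1}, {2, 3}],
      ⟨?_, ?_⟩, ⟨?_, ?_, ?_⟩, ?_, ?_⟩
    · intro X
      have : ∀ X : Finset (Fin 4), (X.erase 0).card = ∑ v ∈ X, (({v} : Finset (Fin 4)).erase 0).card := by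
        decide
      simp only
      exact_mod_cast this X
    · intro v; simp
    · decide
    · decide
    · intro i
      fin_cases i
      · exact aux_conn_single _ _
      · exact aux_conn_single _ _
      · exact aux_conn_pair _ _ _ (by simp [SimpleGraph.pathGraph_adj])
    · intro i j hij hadj
      fin_cases i <;> fin_cases j
      · exact absurd rfl hij
      · exact aux_b_pm ({0} ∪ {1}) 0 _ (by decide) (by decide)
      · exfalso
        rcases hadj with h | ⟨v, hv, w, hw, h⟩
        · exact absurd h (by decide)
        · rw [SimpleGraph.pathGraph_adj] at h
          revert v w
          decide
      · exact aux_b_pm ({1} ∪ {0}) 0 _ (by decide) (by decide)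
      · exact absurd rfl hij
      · exact aux_b_pm ({1} ∪ {2, 3}) 1 _ (by decide) (by decide)
      · exfalso
        rcases hadj with h | ⟨v, hv, w, hw, h⟩
        · exact absurd h (by decide)
        · rw [SimpleGraph.pathGraph_adj] at h
          revert v w
          decide
      · exact aux_b_pm ({2, 3} ∪ {1}) 1 _ (by decide) (by decide)
      · exact absurd rfl hij
    · intro h
      have h1 := h 0
      have h2 : 1 ≤ mms (SimpleGraph.pathGraph 4)
          (fun X : Finset (Fin 4) => ((X.erase 0).card : ℝ)) 3 := by
        refine le_trans ?_ (le_csSup (Set.toFinite _).bddAbove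
          ⟨![{0, 1}, {2}, {3}], ⟨by decide, by decide, ?_⟩, rfl⟩)
        · refine le_ciInf fun i => ?_
          have : ∀ i, 1 ≤ (((![{0, 1}, {2}, {3}] : Fin 3 → Finset (Fin 4)) i).erase 0).card := by
            decide
          exact Nat.one_le_cast.mpr (this i)
        · intro i
          fin_cases i
          · exact aux_conn_pair _ _ _ (by simp [SimpleGraph.pathGraph_adj])
          · exact aux_conn_single _ _
          · exact aux_conn_single _ _
      have h3 : α * 1 ≤ 0 := by
        refine le_trans (mul_le_mul_of_nonneg_left h2 h0.le) (h1.trans (by simp))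
      linarith
end

section
/- For a path graph and n agents with binary additive utility functions, there exists a connected allocation that is simultaneously PMMS and EF1. -/
namespace PathSperner
open Finset
open scoped Fin.CommRing

def D {d : ℕ} (k : Fin (d+2)) : Fin (d+2) → ℤ := Pi.single k 1 - Pi.single (k+1) 1

def wt {d : ℕ} (l : Fin (d+2) → ℤ) : Fin (d+2) := ∑ k, l k • k

lemma wt_add {d : ℕ} (a b : Fin (d+2) → ℤ) : wt (a+b) = wt a + wt b := by
  simp [wt, add_smul, Finset.sum_add_distrib]

lemma wt_sub {d : ℕ} (a b : Fin (d+2) → ℤ) : wt (a-b) = wt a - wt b := by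
  simp [wt, sub_smul, Finset.sum_sub_distrib]

lemma wt_single {d : ℕ} (k : Fin (d+2)) (c : ℤ) : wt (Pi.single k c) = c • k := by
  unfold wt
  rw [Finset.sum_eq_single k]
  · simp
  · intro b _ hb; simp [hb]
  · simp

lemma ne_succ {d : ℕ} (k : Fin (d+2)) : k + 1 ≠ k := by
  simp

structure Cell {d : ℕ} (M : ℤ) (π : Equiv.Perm (Fin (d+2))) (v : Fin (d+2) → Fin (d+2) → ℤ) :
    Prop where
  step : ∀ j, v (j+1) = v j + D (π j)
  nn : ∀ j k, 0 ≤ v j k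
  sm : ∀ j, ∑ k, v j k = M
  w : ∀ j, wt (v j) = -j

def pivV {d : ℕ} (v : Fin (d+2) → Fin (d+2) → ℤ) (j : Fin (d+2)) :=
  Function.update v j (v (j-1) + v (j+1) - v j)

def pivP {d : ℕ} (π : Equiv.Perm (Fin (d+2))) (j : Fin (d+2)) : Equiv.Perm (Fin (d+2)) :=
  (Equiv.swap (j-1) j).trans π

lemma pivV_pivV {d : ℕ} (v : Fin (d+2) → Fin (d+2) → ℤ) (j : Fin (d+2)) :
    pivV (pivV v j) j = v := by
  have h1 : j - 1 ≠ j := by simp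
  have h2 : j + 1 ≠ j := by simp
  unfold pivV
  rw [Function.update_idem]
  simp [Function.update_of_ne h1, Function.update_of_ne h2]

lemma pivP_pivP {d : ℕ} (π : Equiv.Perm (Fin (d+2))) (j : Fin (d+2)) :
    pivP (pivP π j) j = π := by
  ext i; simp [pivP]

lemma pivP_ne {d : ℕ} (π : Equiv.Perm (Fin (d+2))) (j : Fin (d+2)) :
    pivP π j ≠ π := by
  intro h
  have := congrArg (fun f => f j) h
  simp [pivP] at this

/-- The pivot is a cell as soon as it is nonnegative. -/
lemma piv_cell {d : ℕ} {M : ℤ} {π : Equiv.Perm (Fin (d+2))} {v : Fin (d+2) → Fin (d+2) → ℤ}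
    (h : Cell M π v) (j : Fin (d+2)) (hj : ∀ k, 0 ≤ (v (j-1) + v (j+1) - v j) k) :
    Cell M (pivP π j) (pivV v j) := by
  have h1 : j - 1 ≠ j := by simp
  have h2 : j + 1 ≠ j := by simp
  have s1 := h.step (j-1)
  have s2 := h.step j
  rw [sub_add_cancel] at s1
  refine ⟨?_, ?_, ?_, ?_⟩
  · intro i
    unfold pivV pivP
    by_cases hi : i = j
    · subst hi
      rw [Function.update_of_ne h2, Function.update_self]
      simp only [Equiv.trans_apply, Equiv.swap_apply_right]
      rw [s1]; abel
    · by_cases hi' : i + 1 = j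
      · have : i = j - 1 := by rw [← hi']; simp
        subst this
        rw [Function.update_of_ne h1, hi', Function.update_self]
        simp only [Equiv.trans_apply, Equiv.swap_apply_left]
        rw [s2]; abel
      · have : i ≠ j - 1 := by rintro rfl; simp at hi'
        rw [Function.update_of_ne hi, Function.update_of_ne hi']
        simp only [Equiv.trans_apply, Equiv.swap_apply_of_ne_of_ne this hi]
        exact h.step i
  · intro i k
    unfold pivV
    by_cases hi : i = j
    · subst hi; rw [Function.update_self]; exact hj k
    · rw [Function.update_of_ne hi]; exact h.nn i k
  · intro i
    unfold pivV
    by_cases hi : i = j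
    · subst hi; rw [Function.update_self]
      simp [Finset.sum_add_distrib, Finset.sum_sub_distrib, h.sm]
    · rw [Function.update_of_ne hi]; exact h.sm i
  · intro i
    unfold pivV
    by_cases hi : i = j
    · subst hi; rw [Function.update_self, wt_sub, wt_add, h.w, h.w, h.w]; abel
    · rw [Function.update_of_ne hi]; exact h.w i

/-- If a coordinate is not touched between consecutive vertices outside `j`, it is constant. -/
lemma const_of_step {d : ℕ} (f : Fin (d+2) → ℤ) (j : Fin (d+2))
    (h : ∀ i, i ≠ j → i + 1 ≠ j → f (i+1) = f i) : ∀ i, i ≠ j → f i = f (j+1) := by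
  have key : ∀ t : ℕ, t < d + 1 → f (j + 1 + (t : Fin (d+2))) = f (j+1) := by
    intro t
    induction t with
    | zero => intro _; simp
    | succ t ih =>
      intro ht
      rw [← ih (by omega)]
      have := h (j + 1 + (t : Fin (d+2))) ?_ ?_
      · rw [← this]; push_cast; congr 1; abel
      · intro e
        have e2 : ((t + 1 : ℕ) : Fin (d+2)) = 0 := by
          have : j + (((t+1 : ℕ)) : Fin (d+2)) = j + 0 := by
            rw [add_zero]; nth_rewrite 2 [← e]; push_cast; abel
          exact add_left_cancel this
        have := congrArg Fin.val e2
        rw [Fin.val_natCast, Nat.mod_eq_of_lt (by omega)] at this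
        simp at this
      · intro e
        have e2 : ((t + 2 : ℕ) : Fin (d+2)) = 0 := by
          have : j + (((t+1+1 : ℕ)) : Fin (d+2)) = j + 0 := by
            rw [add_zero]; nth_rewrite 2 [← e]; push_cast; abel
          exact add_left_cancel this
        have := congrArg Fin.val e2
        rw [Fin.val_natCast, Nat.mod_eq_of_lt (by omega)] at this
        simp at this
  intro i hi
  have hlt : (i - (j+1)).val < d + 1 := by
    have h1 := (i - (j+1)).isLt
    have h2 : (i - (j+1)).val ≠ d + 1 := by
      intro e
      apply hi
      have : i - (j+1) = -1 := by
        apply Fin.ext; rw [e]; simp [Fin.coe_neg_one]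
      have := congrArg (· + (j+1)) this
      simpa using this
    omega
  have := key _ hlt
  simpa using this

/-- If the pivot is not nonnegative, the facet lies in a coordinate hyperplane. -/
lemma piv_bdry {d : ℕ} {M : ℤ} {π : Equiv.Perm (Fin (d+2))} {v : Fin (d+2) → Fin (d+2) → ℤ}
    (h : Cell M π v) (j : Fin (d+2)) (hj : ¬ ∀ k, 0 ≤ (v (j-1) + v (j+1) - v j) k) :
    ∃ k, ∀ i, i ≠ j → v i k = 0 := by
  push Not at hj
  obtain ⟨k, hk⟩ := hj
  have s1 := h.step (j-1)
  have s2 := h.step j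
  rw [sub_add_cancel] at s1
  have e1 := congrFun s1 k
  have e2 := congrFun s2 k
  simp only [Pi.add_apply, Pi.sub_apply] at hk e1 e2
  have n1 := h.nn (j-1) k
  have n2 := h.nn (j+1) k
  have n3 := h.nn j k
  have hb : D (π j) k = -1 ∧ D (π (j-1)) k = 1 := by
    have : ∀ a, D a k = -1 ∨ D a k = 0 ∨ D a k = 1 := by
      intro a; unfold D; simp only [Pi.sub_apply, Pi.single_apply]; split_ifs <;> simp
    rcases this (π j) with h | h | h <;> rcases this (π (j-1)) with h' | h' | h' <;>
      constructor <;> omega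
  have hp1 : k = π j + 1 := by
    have := hb.1; unfold D at this
    simp only [Pi.sub_apply, Pi.single_apply] at this
    by_contra hc; simp only [hc, if_false] at this; split_ifs at this <;> omega
  have hp2 : k = π (j-1) := by
    have := hb.2; unfold D at this
    simp only [Pi.sub_apply, Pi.single_apply] at this
    by_contra hc; simp only [hc, if_false] at this; split_ifs at this <;> omega
  refine ⟨k, fun i hi => ?_⟩
  rw [const_of_step (fun i => v i k) j ?_ i hi]
  · show v (j+1) k = 0; omega
  · intro i hi hi'
    have := congrFun (h.step i) k
    simp only [Pi.add_apply] at this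
    rw [this]
    have : D (π i) k = 0 := by
      unfold D
      have a1 : ¬ k = π i := by
        intro e; rw [hp2] at e; have := π.injective e; subst this; simp at hi'
      have a2 : ¬ k = π i + 1 := by
        intro e; rw [hp1] at e; exact hi (π.injective (add_right_cancel e)).symm
      simp [Pi.single_apply, a1, a2]
    omega

/-- A cell containing the corner `M e_{-2}` is determined. -/
lemma corner {d : ℕ} {M : ℤ} {π : Equiv.Perm (Fin (d+2))} {v : Fin (d+2) → Fin (d+2) → ℤ}
    (h : Cell M π v) (i0 : Fin (d+2)) (hi0 : v i0 = Pi.single (-1-1) M) :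
    ∀ t, v (i0 + t) = Pi.single (-1-1) (M-1) + Pi.single (-1-1-t) 1 ∧ π (i0+t) = -1-1-1-t := by
  have key : ∀ t : ℕ, v (i0 + (t : Fin (d+2))) =
      Pi.single (-1-1) (M-1) + Pi.single (-1-1-(t : Fin (d+2))) 1 ∧
      π (i0+(t : Fin (d+2))) = -1-1-1-(t : Fin (d+2)) := by
    intro t
    have nx : ∀ t : Fin (d+2), v (i0 + t) = Pi.single (-1-1) (M-1) + Pi.single (-1-1-t) 1 →
        π (i0 + t) = -1-1-1 ∨ π (i0+t) = -1-1-1-t := by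
      intro t e
      by_contra hc
      push Not at hc
      have e1 := congrFun (h.step (i0+t)) (π (i0+t) + 1)
      have e2 := h.nn (i0+t+1) (π (i0+t) + 1)
      rw [e1, e] at e2
      have a1 : ¬ (π (i0+t) + 1 = -1-1) := by
        intro e; apply hc.1; rw [← e]; abel
      have a2 : ¬ (π (i0+t) + 1 = -1-1-t) := by
        intro e; apply hc.2
        have : π (i0+t) = -1-1-t-1 := by rw [← e]; abel
        rw [this]; abel
      unfold D at e2
      simp only [Pi.add_apply, Pi.sub_apply, Pi.single_apply, a1, a2, ne_succ, if_false, if_true] at e2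
      omega
    have hπ0 : π i0 = -1-1-1 := by
      have := nx 0 (by rw [add_zero, hi0, sub_zero, ← Pi.single_add]; simp)
      simpa using this
    induction t with
    | zero =>
      simp only [Nat.cast_zero, add_zero, sub_zero]
      exact ⟨by rw [hi0, ← Pi.single_add]; simp, hπ0⟩
    | succ t ih =>
      have hv : v (i0 + ((t+1 : ℕ) : Fin (d+2))) =
        Pi.single (-1-1) (M-1) + Pi.single (-1-1-((t+1 : ℕ) : Fin (d+2))) 1 := by
        have := h.step (i0 + (t : Fin (d+2)))
        push_cast
        rw [← add_assoc, this, ih.1, ih.2]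
        unfold D
        have a1 : (-1-1-1-(t : Fin (d+2))) + 1 = -1-1-(t : Fin (d+2)) := by abel
        have a2 : (-1-1-1-(t : Fin (d+2))) = -1-1-((t : Fin (d+2))+1) := by abel
        rw [a1, a2]; abel
      refine ⟨hv, ?_⟩
      rcases nx _ hv with e | e
      · rw [← hπ0] at e
        have := π.injective e
        have : ((t+1 : ℕ) : Fin (d+2)) = 0 := by simpa using this
        rw [this, add_zero, sub_zero]; exact hπ0
      · exact e
  intro t
  have := key t.val
  simpa using this

/-- The start cell. -/
lemma corner_cell {d : ℕ} {M : ℤ} (hM : 1 ≤ M) :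
    ∃ (π : Equiv.Perm (Fin (d+2))) (v : Fin (d+2) → Fin (d+2) → ℤ) (i0 : Fin (d+2)),
      Cell M π v ∧ v i0 = Pi.single (-1-1) M := by
  let i0 : Fin (d+2) := - (M • (-1-1))
  refine ⟨(Equiv.subRight i0).trans (Equiv.subLeft (-1-1-1)),
    fun i => Pi.single (-1-1) (M-1) + Pi.single (-1-1-(i - i0)) 1, i0, ⟨?_, ?_, ?_, ?_⟩, ?_⟩
  · intro j
    unfold D
    simp only [Equiv.trans_apply, Equiv.subRight_apply, Equiv.subLeft_apply]
    have a1 : (-1-1-1-(j - i0)) + 1 = -1-1-(j-i0) := by abel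
    have a2 : (-1-1-1-(j-i0)) = -1-1-(j+1-i0) := by abel
    rw [a1, a2]; abel
  · intro j k
    simp only [Pi.add_apply, Pi.single_apply]
    split_ifs <;> omega
  · intro j
    simp [Finset.sum_add_distrib]
  · intro j
    rw [wt_add, wt_single, wt_single, sub_smul]
    have : M • (-1 - 1 : Fin (d+2)) = - i0 := by simp [i0]
    rw [this]; simp only [one_smul]; abel
  · simp only [sub_self, sub_zero]
    rw [← Pi.single_add]; simp

open Classical in
lemma even_of_invol {α : Type*} (s : Finset α) (g : α → α) (h1 : ∀ a ∈ s, g a ∈ s)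
    (h2 : ∀ a ∈ s, g (g a) = a) (h3 : ∀ a ∈ s, g a ≠ a) : Even s.card := by
  have : ∑ a ∈ s, (1 : ZMod 2) = 0 :=
    Finset.sum_involution (fun a _ => g a) (fun a _ => by decide) (fun a ha _ => h3 a ha)
      (fun a ha => h1 a ha) (fun a ha => h2 a ha)
  simp only [sum_const, nsmul_eq_mul, mul_one] at this
  exact (ZMod.natCast_eq_zero_iff_even).1 this


def Dr {d : ℕ} (f : Fin (d+2) → Fin (d+2)) (j : Fin (d+2)) : Prop :=
  (∀ i, i ≠ j → f i ≠ -1) ∧ (∀ a b, a ≠ j → b ≠ j → f a = f b → a = b)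

lemma Dr.surj {d : ℕ} {f : Fin (d+2) → Fin (d+2)} {j : Fin (d+2)} (h : Dr f j) (c : Fin (d+2))
    (hc : c ≠ -1) : ∃ i, i ≠ j ∧ f i = c := by
  have hs : (univ.erase j).image f ⊆ univ.erase (-1) := by
    intro x hx
    simp only [mem_image, mem_erase, mem_univ, and_true] at hx ⊢
    obtain ⟨i, hi, rfl⟩ := hx
    exact h.1 i hi
  have hcard : ((univ.erase j).image f).card = (univ.erase j).card := by
    apply Finset.card_image_of_injOn
    intro a ha b hb e
    simp at ha hb
    exact h.2 a b ha hb e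
  have := Finset.eq_of_subset_of_card_le hs (by rw [hcard]; simp)
  have hc' : c ∈ univ.erase (-1 : Fin (d+2)) := by simp [hc]
  rw [← this] at hc'
  simp only [mem_image, mem_erase, mem_univ, and_true] at hc'
  exact hc'

lemma Dr.bij {d : ℕ} {f : Fin (d+2) → Fin (d+2)} {j : Fin (d+2)} (h : Dr f j)
    (hj : f j = -1) : Function.Bijective f := by
  rw [← Finite.injective_iff_bijective]
  intro a b e
  by_cases ha : a = j
  · by_cases hb : b = j
    · rw [ha, hb]
    · exfalso; apply h.1 b hb; rw [← e, ha, hj]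
  · by_cases hb : b = j
    · exfalso; apply h.1 a ha; rw [e, hb, hj]
    · exact h.2 a b ha hb e

lemma Dr.swap {d : ℕ} {f : Fin (d+2) → Fin (d+2)} {j j' : Fin (d+2)} (h : Dr f j)
    (hj : f j ≠ -1) (hne : j' ≠ j) (he : f j' = f j) : Dr f j' := by
  have hj' := hne
  refine ⟨fun i hi => ?_, fun a b ha hb e => ?_⟩
  · by_cases h' : i = j
    · rw [h']; exact hj
    · exact h.1 i h'
  · by_cases ha' : a = j
    · by_cases hb' : b = j
      · rw [ha', hb']
      · exfalso; apply hb; apply h.2 b j' hb' hj'; rw [← e, ha', he]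
    · by_cases hb' : b = j
      · exfalso; apply ha; apply h.2 a j' ha' hj'; rw [e, hb', he]
      · exact h.2 a b ha' hb' e

lemma neg_two_ne {d : ℕ} : (-1 - 1 : Fin (d+2)) ≠ -1 := by
  simp

open Classical in
theorem sperner {d : ℕ} {M : ℤ} (hM : 1 ≤ M)
    (col : Fin (d+2) → (Fin (d+2) → ℤ) → Fin (d+2))
    (H1 : ∀ j (l : Fin (d+2) → ℤ), (∀ k, 0 ≤ l k) → ∑ k, l k = M → l (col j l) ≠ 0)
    (H2 : ∀ j (l : Fin (d+2) → ℤ), (∀ k, 0 ≤ l k) → ∑ k, l k = M → l (-1) = 0 → ∀ k < col j l, l k = 0) :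
    ∃ π v, Cell M π v ∧ Function.Bijective (fun j => col j (v j)) := by
  by_contra hno
  push Not at hno
  let X := Equiv.Perm (Fin (d+2)) × (Fin (d+2) → Fin (d+2) → ℤ) × Fin (d+2)
  let P : Finset X := (univ ×ˢ (Finset.Icc (fun _ _ => 0) (fun _ _ => M)) ×ˢ univ).filter
    (fun x => Cell M x.1 x.2.1 ∧ Dr (fun i => col i (x.2.1 i)) x.2.2)
  have hP : ∀ x : X, x ∈ P ↔ Cell M x.1 x.2.1 ∧ Dr (fun i => col i (x.2.1 i)) x.2.2 := by
    intro x
    simp only [P, mem_filter, and_iff_right_iff_imp]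
    rintro ⟨hc, -⟩
    refine Finset.mem_product.2 ⟨mem_univ _, Finset.mem_product.2 ⟨Finset.mem_Icc.2
      ⟨fun i k => hc.nn i k, fun i k => ?_⟩, mem_univ _⟩⟩
    show x.2.1 i k ≤ M
    rw [← hc.sm i]
    exact Finset.single_le_sum (f := fun k => x.2.1 i k) (fun k _ => hc.nn i k) (mem_univ k)
  -- involution inside the cells
  have ev : Even P.card := by
    have ex : ∀ x : X, x ∈ P → ∃ j', j' ≠ x.2.2 ∧ col j' (x.2.1 j') = col x.2.2 (x.2.1 x.2.2) := by
      intro x hx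
      obtain ⟨hc, hd⟩ := (hP x).1 hx
      apply hd.surj
      intro h
      exact hno _ _ hc (hd.bij h)
    choose! g hg1 hg2 using ex
    have hmem : ∀ x ∈ P, ((x.1, x.2.1, g x) : X) ∈ P := by
      intro x hx
      have hx' := (hP x).1 hx
      rw [hP]
      refine ⟨hx'.1, hx'.2.swap ?_ (hg1 x hx) (hg2 x hx)⟩
      intro h
      exact hno _ _ hx'.1 (hx'.2.bij h)
    refine even_of_invol P (fun x => (x.1, x.2.1, g x)) hmem ?_ ?_
    · intro x hx
      have hm := hmem x hx
      have a1 := hg1 _ hm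
      have a2 := hg2 _ hm
      simp only at a1 a2
      have : g (x.1, x.2.1, g x) = x.2.2 := by
        by_contra hne
        apply a1
        apply ((hP x).1 hx).2.2 _ _ hne (hg1 x hx)
        exact a2
      simp only [this]
      rfl
    · intro x hx h
      exact hg1 x hx (congrArg (fun y : X => y.2.2) h)
  -- a door whose pivot leaves the simplex contains the corner
  have bd : ∀ x ∈ P, (¬ ∀ k, 0 ≤ (x.2.1 (x.2.2-1) + x.2.1 (x.2.2+1) - x.2.1 x.2.2) k) →
      ∃ i0, x.2.1 i0 = Pi.single (-1-1) M ∧ x.2.2 = i0 - 1 := by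
    intro x hx hneg
    obtain ⟨hc, hd⟩ := (hP x).1 hx
    obtain ⟨k, hk⟩ := piv_bdry hc _ hneg
    have hk1 : k = -1 := by
      by_contra hne
      obtain ⟨i, hi, hi'⟩ := hd.surj k hne
      have := H1 i (x.2.1 i) (hc.nn i) (hc.sm i)
      rw [hi'] at this
      exact this (hk i hi)
    subst hk1
    obtain ⟨i, hi, hi'⟩ := hd.surj (-1-1) neg_two_ne
    have h2 := H2 i (x.2.1 i) (hc.nn i) (hc.sm i) (hk i hi)
    rw [hi'] at h2
    have hz : ∀ k, k ≠ -1-1 → x.2.1 i k = 0 := by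
      intro k hk'
      by_cases hk2 : k = -1
      · rw [hk2]; exact hk i hi
      · apply h2
        have v1 : (-1 : Fin (d+2)).val = d + 1 := Fin.coe_neg_one
        have v2 : (-1-1 : Fin (d+2)).val = d := by
          rw [Fin.coe_sub_one]; simp
        have n1 : k.val ≠ d + 1 := fun h => hk2 (Fin.ext (by rw [h, v1]))
        have n2 : k.val ≠ d := fun h => hk' (Fin.ext (by rw [h, v2]))
        rw [Fin.lt_def, v2]
        have := k.isLt
        omega
    have hcor : x.2.1 i = Pi.single (-1-1) M := by
      funext k
      by_cases hk' : k = -1-1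
      · subst hk'
        rw [Pi.single_eq_same]
        have := hc.sm i
        rw [Finset.sum_eq_single (-1-1)] at this
        · exact this
        · intro b _ hb; exact hz b hb
        · simp
      · rw [Pi.single_eq_of_ne hk']; exact hz k hk'
    refine ⟨i, hcor, ?_⟩
    by_contra hne
    have h0 := hk (i-1) (Ne.symm hne)
    have := (corner hc i hcor (-1)).1
    rw [← sub_eq_add_neg] at this
    rw [this] at h0
    have e : (-1 - 1 - (-1) : Fin (d+2)) = -1 := by abel
    rw [e] at h0
    simp only [Pi.add_apply, Pi.single_apply, neg_two_ne.symm, if_false, if_true] at h0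
    omega
  -- uniqueness
  have uq : ∀ x y : X, Cell M x.1 x.2.1 → Cell M y.1 y.2.1 →
      (∃ i0, x.2.1 i0 = Pi.single (-1-1) M ∧ x.2.2 = i0 - 1) →
      (∃ i0, y.2.1 i0 = Pi.single (-1-1) M ∧ y.2.2 = i0 - 1) → x = y := by
    rintro ⟨π, v, j⟩ ⟨π', v', j'⟩ hx hy ⟨i, hi, hij⟩ ⟨i', hi', hij'⟩
    simp only at hx hy hi hij hi' hij'
    have e : i = i' := by
      have a := hx.w i
      have b := hy.w i'
      rw [hi] at a; rw [hi'] at b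
      exact neg_injective (a.symm.trans b)
    subst e
    have c1 := corner hx i hi
    have c2 := corner hy i hi'
    have hv : v = v' := by
      funext t
      have a := (c1 (t - i)).1
      have b := (c2 (t - i)).1
      rw [add_sub_cancel] at a b
      rw [a, b]
    have hp : π = π' := by
      apply Equiv.ext
      intro t
      have a := (c1 (t - i)).2
      have b := (c2 (t - i)).2
      rw [add_sub_cancel] at a b
      rw [a, b]
    rw [hv, hp, hij, hij']
  -- the start door
  obtain ⟨π0, v0, i0, hc0, hi0⟩ := corner_cell (d := d) hM
  have cor0 := corner hc0 i0 hi0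
  let x0 : X := (π0, v0, i0 - 1)
  have colv : ∀ t : Fin (d+2), t ≠ -1 → col (i0+t) (v0 (i0+t)) = -1-1-t := by
    intro t ht
    have hne : (-1-1-t : Fin (d+2)) ≠ -1 := by
      intro h
      apply ht
      have : t = -1 - 1 - (-1-1-t) := by abel
      rw [this, h]; abel
    have hv := (cor0 t).1
    have hl : v0 (i0+t) (-1) = 0 := by
      rw [hv]
      simp only [Pi.add_apply, Pi.single_apply, neg_two_ne.symm, hne.symm, if_false]
      rfl
    have h1 := H1 (i0+t) (v0 (i0+t)) (hc0.nn _) (hc0.sm _)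
    have h2 := H2 (i0+t) (v0 (i0+t)) (hc0.nn _) (hc0.sm _) hl
    set c := col (i0+t) (v0 (i0+t)) with hcdef
    rw [hv] at h1
    by_contra hcne
    have hc2 : c = -1-1 := by
      by_contra hc2
      apply h1
      simp only [Pi.add_apply, Pi.single_apply, hcne, hc2, if_false]
      rfl
    have hlt : (-1-1-t : Fin (d+2)) < c := by
      rw [hc2]
      have v1 : (-1 : Fin (d+2)).val = d + 1 := Fin.coe_neg_one
      have v2 : (-1-1 : Fin (d+2)).val = d := by
        rw [Fin.coe_sub_one]; simp
      rw [hc2] at hcne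
      have n1 : (-1-1-t : Fin (d+2)).val ≠ d + 1 := fun h => hne (Fin.ext (by rw [h, v1]))
      have n2 : (-1-1-t : Fin (d+2)).val ≠ d := fun h => hcne (Fin.ext (by rw [h, v2]))
      rw [Fin.lt_def, v2]
      have := (-1-1-t : Fin (d+2)).isLt
      omega
    have := h2 _ hlt
    rw [hv] at this
    simp only [Pi.add_apply, Pi.single_apply, if_true] at this
    split_ifs at this <;> omega
  have colv' : ∀ i, i ≠ i0 - 1 → col i (v0 i) = -1-1-(i - i0) := by
    intro i hi
    have := colv (i - i0) (by
      intro h; apply hi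
      have : i = i0 + (i - i0) := by abel
      rw [this, h]; abel)
    rwa [add_sub_cancel] at this
  have hx0 : x0 ∈ P := by
    rw [hP]
    refine ⟨hc0, fun i hi => ?_, fun a b ha hb e => ?_⟩
    · simp only [x0] at hi ⊢
      rw [colv' i hi]
      intro h
      apply hi
      have : i = i0 + (-1 - 1 - (-1-1-(i-i0))) := by abel
      rw [this, h]; abel
    · simp only [x0] at ha hb e
      rw [colv' a ha, colv' b hb] at e
      have : a = i0 + (-1 - 1 - (-1-1-(a-i0))) := by abel
      rw [this, e]; abel
  have hx0neg : ¬ ∀ k, 0 ≤ (v0 (i0-1-1) + v0 (i0-1+1) - v0 (i0-1)) k := by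
    intro h
    have h := h (-1)
    have a1 := (cor0 (-1)).1
    have a2 := (cor0 (-1-1)).1
    rw [← sub_eq_add_neg] at a1
    have e1 : i0 + (-1-1) = i0 - 1 - 1 := by abel
    have e2 : (-1 - 1 - (-1) : Fin (d+2)) = -1 := by abel
    have e3 : (-1 - 1 - (-1-1) : Fin (d+2)) = 0 := by abel
    rw [e1, e3] at a2
    rw [e2] at a1
    rw [a1, a2, sub_add_cancel, hi0] at h
    have z : ¬ (-1 : Fin (d+2)) = 0 := by simp
    simp only [Pi.add_apply, Pi.sub_apply, Pi.single_apply, neg_two_ne.symm, z, if_false,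
      if_true] at h
    omega
  -- the pivot involution
  have od : Even (P.erase x0).card := by
    have hst : ∀ x ∈ P.erase x0,
        ∀ k, 0 ≤ (x.2.1 (x.2.2-1) + x.2.1 (x.2.2+1) - x.2.1 x.2.2) k := by
      intro x hx
      by_contra hneg
      rw [mem_erase] at hx
      exact hx.1 (uq x x0 ((hP x).1 hx.2).1 hc0 (bd x hx.2 hneg) ⟨i0, hi0, rfl⟩)
    refine even_of_invol _ (fun x => (pivP x.1 x.2.2, pivV x.2.1 x.2.2, x.2.2)) ?_ ?_ ?_
    · intro x hx
      have hx' := (mem_erase.1 hx)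
      have hcd := (hP x).1 hx'.2
      rw [mem_erase]
      constructor
      · intro h
        have a1 : pivV x.2.1 x.2.2 = v0 := congrArg (fun y : X => y.2.1) h
        have a2 : x.2.2 = i0 - 1 := congrArg (fun y : X => y.2.2) h
        apply hx0neg
        have h1 : x.2.2 - 1 ≠ x.2.2 := by simp
        have h2 : x.2.2 + 1 ≠ x.2.2 := by simp
        rw [← a2, ← a1]
        unfold pivV
        rw [Function.update_of_ne h1, Function.update_of_ne h2, Function.update_self]
        intro k
        have := hcd.1.nn x.2.2 k
        simpa using this
      · rw [hP]
        refine ⟨piv_cell hcd.1 _ (hst x hx), ?_, ?_⟩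
        · intro i hi
          simp only [pivV] at hi ⊢
          rw [Function.update_of_ne hi]
          exact hcd.2.1 i hi
        · intro a b ha hb
          simp only [pivV] at ha hb ⊢
          rw [Function.update_of_ne ha, Function.update_of_ne hb]
          exact hcd.2.2 a b ha hb
    · intro x hx
      simp only [pivV_pivV, pivP_pivP]
      rfl
    · intro x hx h
      exact pivP_ne _ _ (congrArg (fun y : X => y.1) h)
  rw [Finset.card_erase_of_mem hx0] at od
  have hpos : 0 < P.card := Finset.card_pos.2 ⟨x0, hx0⟩
  obtain ⟨a, ha⟩ := ev
  obtain ⟨b, hb⟩ := od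
  omega

def cut {d : ℕ} (l : Fin (d+2) → ℤ) (k : ℕ) : ℤ := ∑ i : Fin (d+2), if i.val < k then l i else 0

lemma cut_zero {d : ℕ} (l : Fin (d+2) → ℤ) : cut l 0 = 0 := by simp [cut]

lemma cut_succ {d : ℕ} (l : Fin (d+2) → ℤ) (k : Fin (d+2)) :
    cut l (k.val+1) = cut l k.val + l k := by
  have : l k = ∑ i : Fin (d+2), if i = k then l i else 0 := by simp
  rw [this]
  unfold cut
  rw [← Finset.sum_add_distrib]
  apply Finset.sum_congr rfl
  intro i _
  by_cases h : i = k
  · subst h; simp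
  · have : i.val ≠ k.val := fun e => h (Fin.ext e)
    by_cases h' : i.val < k.val
    · simp [h, h', Nat.lt_succ_of_lt h']
    · have : ¬ i.val < k.val + 1 := by omega
      simp [h, h', this]

lemma cut_full {d : ℕ} (l : Fin (d+2) → ℤ) : cut l (d+2) = ∑ k, l k := by
  unfold cut
  apply Finset.sum_congr rfl
  intro i _; simp [i.isLt]

lemma cut_mono {d : ℕ} (l : Fin (d+2) → ℤ) (h : ∀ k, 0 ≤ l k) {a b : ℕ} (hab : a ≤ b) :
    cut l a ≤ cut l b := by
  unfold cut
  apply Finset.sum_le_sum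
  intro i _
  have := h i
  split_ifs <;> omega

lemma cut_nonneg {d : ℕ} (l : Fin (d+2) → ℤ) (h : ∀ k, 0 ≤ l k) (a : ℕ) : 0 ≤ cut l a := by
  rw [← cut_zero l]; exact cut_mono l h (Nat.zero_le _)

lemma cut_add {d : ℕ} (a b : Fin (d+2) → ℤ) (k : ℕ) : cut (a+b) k = cut a k + cut b k := by
  unfold cut
  rw [← Finset.sum_add_distrib]
  apply Finset.sum_congr rfl
  intro i _
  simp only [Pi.add_apply]; split_ifs <;> simp

lemma cut_D {d : ℕ} (a : Fin (d+2)) (k : ℕ) :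
    cut (D a) k = (if a.val < k then 1 else 0) - (if (a+1).val < k then 1 else 0) := by
  unfold cut D
  have : ∀ i : Fin (d+2), (if i.val < k then
      (Pi.single a 1 - Pi.single (a+1) 1 : Fin (d+2) → ℤ) i else 0) =
      (if i = a then (if i.val < k then (1:ℤ) else 0) else 0) -
      (if i = a+1 then (if i.val < k then (1:ℤ) else 0) else 0) := by
    intro i
    simp only [Pi.sub_apply, Pi.single_apply]
    split_ifs <;> simp
  rw [Finset.sum_congr rfl (fun i _ => this i), Finset.sum_sub_distrib]
  simp

lemma two_val {d : ℕ} {M : ℤ} {π : Equiv.Perm (Fin (d+2))} {v : Fin (d+2) → Fin (d+2) → ℤ}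
    (h : Cell M π v) (k : ℕ) : k ≤ d + 1 → ∃ Y : ℤ, ∀ j, Y ≤ cut (v j) k ∧ cut (v j) k ≤ Y + 1 := by
  intro hk
  rcases Nat.eq_zero_or_pos k with h0 | h0
  · subst h0; exact ⟨0, fun j => by simp [cut_zero]⟩
  let a' : Fin (d+2) := ⟨k-1, by omega⟩
  let b : Fin (d+2) := π.symm (-1) + 1
  have key : ∀ t : ℕ, t ≤ d + 1 → cut (v (b + (t : Fin (d+2)))) k = cut (v b) k +
      (if (π.symm a' - b).val < t then 1 else 0) := by
    intro t
    induction t with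
    | zero => intro _; simp
    | succ t ih =>
      intro ht
      have st := h.step (b + (t : Fin (d+2)))
      have e : b + ((t+1 : ℕ) : Fin (d+2)) = b + (t : Fin (d+2)) + 1 := by push_cast; abel
      have tv : ((t : Fin (d+2))).val = t := by
        rw [Fin.val_natCast, Nat.mod_eq_of_lt (by omega)]
      rw [e, st, cut_add, ih (by omega), cut_D]
      have hne : π (b + (t : Fin (d+2))) ≠ -1 := by
        intro hc
        have h1 : b + (t : Fin (d+2)) = π.symm (-1) := by rw [← hc]; simp
        have h2 : ((t+1 : ℕ) : Fin (d+2)) = 0 := by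
          have : π.symm (-1) + ((t+1 : ℕ) : Fin (d+2)) = π.symm (-1) + 0 := by
            rw [add_zero]; nth_rewrite 2 [← h1]; push_cast; simp only [b]; abel
          exact add_left_cancel this
        have := congrArg Fin.val h2
        rw [Fin.val_natCast, Nat.mod_eq_of_lt (by omega)] at this
        simp at this
      have hval : (π (b + (t : Fin (d+2))) + 1).val = (π (b + (t : Fin (d+2)))).val + 1 := by
        apply Fin.val_add_one_of_lt
        rw [Fin.lt_last_iff_ne_last]
        intro hc; apply hne; rw [hc]; apply Fin.ext; rw [Fin.coe_neg_one]; rfl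
      rw [hval]
      have hiff : (π (b + (t : Fin (d+2)))).val = k - 1 ↔ (π.symm a' - b).val = t := by
        constructor
        · intro h1
          have : π (b + (t : Fin (d+2))) = a' := Fin.ext h1
          rw [← this]; simp [tv]
        · intro h1
          have : π.symm a' - b = (t : Fin (d+2)) := Fin.ext (by rw [h1, tv])
          rw [← this]; simp [a']
      generalize (π (b + (t : Fin (d+2)))).val = A at *
      generalize (π.symm a' - b).val = B at *
      split_ifs <;> omega
  refine ⟨cut (v b) k, fun j => ?_⟩
  have := key (j - b).val (by have := (j-b).isLt; omega)
  rw [Fin.cast_val_eq_self, add_sub_cancel] at this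
  rw [this]
  split_ifs <;> omega

def G (N : ℕ) (p : ℕ → ℕ) (c : ℕ) : ℕ := ∑ x ∈ range c, p (x / N)

lemma G_eq (N : ℕ) (hN : 0 < N) (p : ℕ → ℕ) (c : ℕ) :
    G N p c = N * (∑ x ∈ range (c/N), p x) + (c % N) * p (c / N) := by
  induction c with
  | zero => simp [G]
  | succ c ih =>
    have : G N p (c+1) = G N p c + p (c/N) := by simp [G, Finset.sum_range_succ]
    rw [this, ih]
    have hm := Nat.mod_lt c hN
    have hd := Nat.div_add_mod c N
    by_cases h : c % N + 1 < N
    · have e1 : (c+1)/N = c/N := by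
        rw [Nat.div_eq_iff hN]
        constructor
        · have := Nat.div_mul_le_self c N; omega
        · have : c / N * N = N * (c/N) := mul_comm _ _
          omega
      have e2 : (c+1) % N = c % N + 1 := by
        have := Nat.div_add_mod (c+1) N
        rw [e1] at this; omega
      rw [e1, e2]; ring
    · have e1 : (c+1)/N = c/N + 1 := by
        have : c + 1 = N * (c/N+1) := by rw [mul_add]; omega
        rw [this, Nat.mul_div_cancel_left _ hN]
      have e2 : (c+1) % N = 0 := by
        have := Nat.div_add_mod (c+1) N
        rw [e1, mul_add] at this; omega
      rw [e1, e2, Finset.sum_range_succ]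
      have : c % N + 1 = N := by omega
      have h3 : c % N * p (c/N) + p (c/N) = N * p (c/N) := by
        calc c % N * p (c/N) + p (c/N) = (c % N + 1) * p (c/N) := by ring
          _ = N * p (c/N) := by rw [this]
      rw [mul_add]; omega

lemma G_round (N : ℕ) (p : ℕ → ℕ) (hp : ∀ x, p x ≤ 1) (c s : ℕ) (hs : s < N) :
    (G N p c + s) / N = ∑ x ∈ range ((c+s)/N), p x := by
  have hN : 0 < N := by omega
  rw [G_eq N hN]
  have hm := Nat.mod_lt c hN
  have hd := Nat.div_add_mod c N
  have hc : (c + s) / N = c / N + (c % N + s) / N := by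
    nth_rewrite 1 [← hd]
    rw [add_assoc, Nat.mul_add_div hN]
  rw [add_assoc, Nat.mul_add_div hN, hc]
  have h01 : p (c/N) = 0 ∨ p (c/N) = 1 := by have := hp (c/N); omega
  by_cases h : c % N + s < N
  · rw [Nat.div_eq_of_lt h, add_zero]
    have : (c % N * p (c / N) + s) / N = 0 := by
      rcases h01 with e | e <;> rw [e] <;> apply Nat.div_eq_of_lt <;> omega
    omega
  · have e : (c % N + s) / N = 1 := by
      rw [Nat.div_eq_iff hN]; omega
    rw [e, Finset.sum_range_succ]
    congr 1
    rcases h01 with e' | e' <;> rw [e']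
    · rw [mul_zero, zero_add]; exact Nat.div_eq_of_lt hs
    · rw [mul_one]; exact e

lemma G_mono (N : ℕ) (p : ℕ → ℕ) {a b : ℕ} (h : a ≤ b) : G N p a ≤ G N p b := by
  unfold G
  exact Finset.sum_le_sum_of_subset (Finset.range_mono h)

lemma div_ineq (N a b c e : ℤ) (hN : 0 < N) (h : a - b ≤ c - e) :
    a / N - b / N ≤ c / N - e / N + 1 := by
  have h1 := Int.mul_ediv_add_emod a N
  have h2 := Int.mul_ediv_add_emod b N
  have h3 := Int.mul_ediv_add_emod c N
  have h4 := Int.mul_ediv_add_emod e N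
  have l1 := Int.emod_nonneg a hN.ne'
  have l2 := Int.emod_lt_of_pos b hN
  have l3 := Int.emod_lt_of_pos c hN
  have l4 := Int.emod_nonneg e hN.ne'
  by_contra hc
  have : 2 ≤ a/N - b/N - c/N + e/N := by omega
  nlinarith

lemma choose_shift (d : ℕ) (Y : ℕ → ℤ) : ∃ s : ℕ, s < d + 2 ∧ ∀ k : ℕ, 1 ≤ k → k ≤ d + 1 →
    ¬ ((d + 2 : ℕ) : ℤ) ∣ Y k + s + 1 := by
  by_contra hc
  push Not at hc
  choose! K hK1 hK2 hK3 using hc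
  obtain ⟨x, y, hxy, he⟩ := Fintype.exists_ne_map_eq_of_card_lt
    (fun s : Fin (d+2) => (⟨K s.val - 1, by
      have := hK1 s.val s.isLt; have := hK2 s.val s.isLt; omega⟩ : Fin (d+1))) (by simp)
  have e : K x.val = K y.val := by
    have := congrArg Fin.val he
    simp only at this
    have := hK1 x.val x.isLt; have := hK1 y.val y.isLt; omega
  have a := hK3 x.val x.isLt
  have b := hK3 y.val y.isLt
  rw [e] at a
  have := dvd_sub a b
  have e2 : Y (K y.val) + (x.val : ℤ) + 1 - (Y (K y.val) + (y.val : ℤ) + 1) = x.val - y.val := by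
    ring
  rw [e2] at this
  apply hxy
  apply Fin.ext
  have hx := x.isLt
  have hy := y.isLt
  have := Int.eq_zero_of_abs_lt_dvd this (by rw [abs_lt]; constructor <;> push_cast <;> omega)
  omega

lemma div_stable (N : ℕ) (Y : ℤ) (s : ℕ) (h : ¬ (N : ℤ) ∣ Y + s + 1) (a b : ℕ)
    (ha : Y ≤ a ∧ (a : ℤ) ≤ Y + 1) (hb : Y ≤ b ∧ (b : ℤ) ≤ Y + 1) : (a + s) / N = (b + s) / N := by
  have aux : ∀ a : ℕ, (a : ℤ) = Y → (a + s) / N = (a + 1 + s) / N := by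
    intro a e
    have : ¬ N ∣ (a + s) + 1 := by
      intro hd
      apply h
      have : ((a + s + 1 : ℕ) : ℤ) = Y + s + 1 := by push_cast; rw [e]
      rw [← this]; exact_mod_cast hd
    have h2 := Nat.succ_div_of_not_dvd this
    rw [← h2]; congr 1; omega
  have h1 : (a : ℤ) = Y ∨ (a : ℤ) = Y + 1 := by omega
  have h2 : (b : ℤ) = Y ∨ (b : ℤ) = Y + 1 := by omega
  rcases h1 with h1 | h1 <;> rcases h2 with h2 | h2
  · have : a = b := by omega
    rw [this]
  · have : b = a + 1 := by omega
    rw [this]; exact aux a h1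
  · have : a = b + 1 := by omega
    rw [this]; exact (aux b h2).symm
  · have : a = b := by omega
    rw [this]

theorem core (d m : ℕ) (hm : 0 < m) (p : Fin (d+2) → ℕ → ℕ) (hp : ∀ i x, p i x ≤ 1)
    (hz : ∀ i x, m ≤ x → p i x = 0) (hpos : ∀ i, ∃ x, p i x ≠ 0) :
    ∃ (R : ℕ → ℕ) (f : Fin (d+2) → Fin (d+2)), Function.Bijective f ∧ R 0 = 0 ∧ R (d+2) = m ∧
      (∀ k, k ≤ d + 1 → R k ≤ R (k+1)) ∧
      ∀ i k : Fin (d+2), (∑ x ∈ range (R (k.val+1)), p i x) + ∑ x ∈ range (R (f i).val), p i x ≤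
        (∑ x ∈ range (R ((f i).val+1)), p i x) + (∑ x ∈ range (R k.val), p i x) + 1 := by
  obtain ⟨N, hN⟩ : ∃ N, N = d + 2 := ⟨_, rfl⟩
  have hN0 : 0 < N := by omega
  obtain ⟨M, hMM⟩ : ∃ M : ℕ, M = N * m + 1 := ⟨_, rfl⟩
  have hGc : ∀ i c, N * m ≤ c → G N (p i) c = G N (p i) (N*m) := by
    intro i c hc
    unfold G
    symm
    apply Finset.sum_subset (Finset.range_mono hc)
    intro x _ hx
    apply hz
    rw [Nat.le_div_iff_mul_le hN0, mul_comm]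
    simpa using hx
  have hGpos : ∀ i, 0 < G N (p i) M := by
    intro i
    rw [hGc i M (by omega)]
    obtain ⟨x, hx⟩ := hpos i
    have hxm : x < m := by
      by_contra h; exact hx (hz i x (by omega))
    unfold G
    apply Finset.sum_pos'
    · intros; positivity
    · refine ⟨N * x, ?_, ?_⟩
      · rw [Finset.mem_range]; exact Nat.mul_lt_mul_of_pos_left hxm hN0
      · rw [Nat.mul_div_cancel_left _ hN0]; omega
  let g : Fin (d+2) → (Fin (d+2) → ℤ) → ℕ → ℤ := fun j l k => (G N (p j) (cut l k).toNat : ℤ)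
  have exc : ∀ (j : Fin (d+2)) (l : Fin (d+2) → ℤ), ∃ c : Fin (d+2), (∀ k, 0 ≤ l k) →
      ∑ k, l k = (M : ℤ) → l c ≠ 0 ∧ (l (-1) = 0 → ∀ k < c, l k = 0) ∧
      (l (-1) ≠ 0 → (∀ k : Fin (d+2), g j l (k.val+1) - g j l k.val ≤ g j l (c.val+1) - g j l c.val)
        ∧ 0 < g j l (c.val+1) - g j l c.val) := by
    intro j l
    by_cases hh : (∀ k, 0 ≤ l k) ∧ ∑ k, l k = (M : ℤ)
    swap
    · exact ⟨0, fun a b => absurd ⟨a, b⟩ hh⟩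
    obtain ⟨h0, h1⟩ := hh
    by_cases hl : l (-1) = 0
    · have hne : (univ.filter (fun k => l k ≠ 0)).Nonempty := by
        by_contra hc
        rw [Finset.not_nonempty_iff_eq_empty, Finset.filter_eq_empty_iff] at hc
        rw [Finset.sum_eq_zero (fun k hk => by simpa using hc hk)] at h1
        omega
      refine ⟨(univ.filter (fun k => l k ≠ 0)).min' hne, fun _ _ => ⟨?_, ?_, fun h => absurd hl h⟩⟩
      · have := Finset.min'_mem _ hne
        simpa using this
      · intro _ k hk
        by_contra hk0
        have := Finset.min'_le (univ.filter (fun k => l k ≠ 0)) k (by simpa using hk0)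
        exact absurd hk (not_lt.2 this)
    · obtain ⟨c, hc⟩ := Finite.exists_max
        (fun k : Fin (d+2) => g j l (k.val+1) - g j l k.val)
      have hcpos : 0 < g j l (c.val+1) - g j l c.val := by
        by_contra hneg
        have hk : ∀ k, k ≤ d + 2 → g j l k ≤ 0 := by
          intro k
          induction k with
          | zero => intro _; simp [g, cut_zero, G]
          | succ k ih =>
            intro hk
            have a := ih (by omega)
            have b := hc ⟨k, by omega⟩
            simp only at b
            omega
        have := hk (d+2) le_rfl
        simp only [g, cut_full, h1, Int.toNat_natCast] at this
        have := hGpos j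
        omega
      refine ⟨c, fun _ _ => ⟨?_, fun h => absurd h hl, fun _ => ⟨hc, hcpos⟩⟩⟩
      intro hlc
      simp only [g, cut_succ, hlc, add_zero, sub_self] at hcpos
      omega
  choose col hcol using exc
  obtain ⟨π, v, hcell, hbij⟩ := sperner (M := (M : ℤ)) (by omega) col
    (fun j l a b => (hcol j l a b).1) (fun j l a b => (hcol j l a b).2.1)
  have hcv := fun j => hcol j (v j) (hcell.nn j) (hcell.sm j)
  choose! Y hY using two_val hcell
  have v1 : (-1 : Fin (d+2)).val = d + 1 := Fin.coe_neg_one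
  have hlastv : ∀ j, cut (v j) (d+1) + v j (-1) = M := by
    intro j
    have := cut_succ (v j) (-1)
    rw [v1] at this
    rw [← this, ← hcell.sm j]; exact cut_full (v j)
  -- all vertices have their last cut at most `N * m`
  have hlast : ∀ j, cut (v j) (d+1) ≤ (N * m : ℕ) := by
    obtain ⟨j1, hj1⟩ := hbij.2 (-1)
    simp only at hj1
    have h1 := hcv j1
    rw [hj1] at h1
    have h2 := (h1.2.2 h1.1).2
    have h3 : cut (v j1) (d+1) < (N * m : ℕ) := by
      by_contra hc
      have e1 : g j1 (v j1) (d+1) = G N (p j1) (N*m) := by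
        simp only [g]; rw [hGc]; omega
      have e2 : g j1 (v j1) (d+1+1) = G N (p j1) (N*m) := by
        simp only [g]; rw [hGc]
        have := cut_mono (v j1) (hcell.nn j1) (Nat.le_succ (d+1))
        have : cut (v j1) (d+1) ≤ cut (v j1) (d+1+1) := this
        omega
      rw [v1, e1, e2] at h2
      omega
    intro j
    have a := hY (d+1) le_rfl j1
    have b := hY (d+1) le_rfl j
    omega
  have hpref : ∀ j k : Fin (d+2), g j (v j) (k.val+1) - g j (v j) k.val ≤
      g j (v j) ((col j (v j)).val+1) - g j (v j) (col j (v j)).val := by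
    intro j
    refine ((hcv j).2.2 ?_).1
    have := hlast j
    have := hlastv j
    omega
  obtain ⟨s, hs, hsk⟩ := choose_shift d Y
  rw [← hN] at hs hsk
  let R : ℕ → ℕ := fun k => if k = d + 2 then m else ((cut (v 0) k).toNat + s) / N
  have hR : ∀ j k, k ≤ d + 1 → R k = ((cut (v j) k).toNat + s) / N := by
    intro j k hk
    have : k ≠ d + 2 := by omega
    simp only [R, this, if_false]
    rcases Nat.eq_zero_or_pos k with h0 | h0
    · subst h0; simp [cut_zero]
    · apply div_stable N (Y k) s (hsk k h0 hk)
      · have := hY k hk 0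
        have := cut_nonneg (v 0) (hcell.nn 0) k
        omega
      · have := hY k hk j
        have := cut_nonneg (v j) (hcell.nn j) k
        omega
  have hNm : (N * m + s) / N = m := by
    rw [Nat.mul_add_div hN0, Nat.div_eq_of_lt hs, add_zero]
  have hRn : R (d+2) = m := by simp [R]
  have hf : ∀ j k, k ≤ d + 2 → ((∑ x ∈ range (R k), p j x : ℕ) : ℤ) = (g j (v j) k + s) / N := by
    intro j k hk
    have : ∑ x ∈ range (R k), p j x = (G N (p j) (cut (v j) k).toNat + s) / N := by
      by_cases h : k = d + 2
      · subst h
        rw [hRn, cut_full, hcell.sm, Int.toNat_natCast, hGc j M (by omega),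
          G_round N (p j) (hp j) _ s hs, hNm]
      · rw [G_round N (p j) (hp j) _ s hs, ← hR j k (by omega)]
    rw [this]; push_cast; rfl
  refine ⟨R, fun j => col j (v j), hbij, ?_, hRn, ?_, ?_⟩
  · rw [hR 0 0 (by omega), cut_zero]; simpa using Or.inr hs
  · intro k hk
    by_cases h : k = d + 1
    · subst h
      rw [hRn, hR 0 _ le_rfl]
      have := hlast 0
      refine le_trans (Nat.div_le_div_right (?_ : _ ≤ N * m + s)) hNm.le
      omega
    · rw [hR 0 k hk, hR 0 (k+1) (by omega)]
      apply Nat.div_le_div_right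
      have := cut_mono (v 0) (hcell.nn 0) (Nat.le_succ k)
      have : cut (v 0) k ≤ cut (v 0) (k+1) := this
      omega
  · intro j k
    have hk := k.isLt
    have hc := (col j (v j)).isLt
    have a1 := hf j (k.val+1) (by omega)
    have a2 := hf j k.val (by omega)
    have a3 := hf j ((col j (v j)).val+1) (by omega)
    have a4 := hf j (col j (v j)).val (by omega)
    have := div_ineq N (g j (v j) (k.val+1) + s) (g j (v j) k.val + s)
      (g j (v j) ((col j (v j)).val+1) + s) (g j (v j) (col j (v j)).val + s)
      (by omega) (by have := hpref j k; omega)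
    rw [← a1, ← a2, ← a3, ← a4] at this
    simp only
    omega

end PathSperner

namespace GraphFair
open Finset

lemma itv_conn (m a b : ℕ) : BundleConn (SimpleGraph.pathGraph m) (itv m a b) := by
  by_cases he : itv m a b = ∅
  · exact Or.inl he
  right
  have hmem : ∀ x : Fin m, x ∈ ((itv m a b : Finset (Fin m)) : Set (Fin m)) ↔
      a ≤ x.val ∧ x.val < b := by
    intro x; simp [itv]
  obtain ⟨x0, hx0⟩ := Finset.nonempty_iff_ne_empty.2 he
  have hx0' := (hmem x0).1 hx0
  have ham : a < m := by have := x0.isLt; omega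
  have ha : (⟨a, ham⟩ : Fin m) ∈ ((itv m a b : Finset (Fin m)) : Set (Fin m)) :=
    (hmem _).2 ⟨le_rfl, by simp only; omega⟩
  have key : ∀ t : ℕ, ∀ (x : Fin m) (hx : x ∈ ((itv m a b : Finset (Fin m)) : Set (Fin m))),
      x.val = a + t →
      ((SimpleGraph.pathGraph m).induce ((itv m a b : Finset (Fin m)) : Set (Fin m))).Reachable
        ⟨⟨a, ham⟩, ha⟩ ⟨x, hx⟩ := by
    intro t
    induction t with
    | zero =>
      intro x hx e
      have : x = ⟨a, ham⟩ := Fin.ext (by simpa using e)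
      subst this
      exact SimpleGraph.Reachable.refl _
    | succ t ih =>
      intro x hx e
      have hx' := (hmem x).1 hx
      have hy : (⟨a + t, by have := x.isLt; omega⟩ : Fin m) ∈
          ((itv m a b : Finset (Fin m)) : Set (Fin m)) :=
        (hmem _).2 ⟨by simp only; omega, by simp only; omega⟩
      refine (ih _ hy rfl).trans (SimpleGraph.Adj.reachable ?_)
      rw [SimpleGraph.comap_adj]
      rw [SimpleGraph.pathGraph_adj]
      left
      simp only [Function.Embedding.subtype_apply]
      omega
  have hr : ∀ x, ((SimpleGraph.pathGraph m).induce
      ((itv m a b : Finset (Fin m)) : Set (Fin m))).Reachable ⟨⟨a, ham⟩, ha⟩ x := by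
    rintro ⟨x, hx⟩
    exact key (x.val - a) x hx (by have := (hmem x).1 hx; omega)
  haveI : Nonempty ((itv m a b : Finset (Fin m)) : Set (Fin m)) := ⟨⟨_, ha⟩⟩
  exact ⟨fun x y => (hr x).symm.trans (hr y)⟩

/-- The natural-number valued utility. -/
noncomputable def qv {m : ℕ} (u : Finset (Fin m) → ℝ) (x : ℕ) : ℕ :=
  open Classical in if h : x < m then (if u {⟨x, h⟩} = 1 then 1 else 0) else 0

lemma qv_le {m : ℕ} (u : Finset (Fin m) → ℝ) (x : ℕ) : qv u x ≤ 1 := by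
  unfold qv; split_ifs <;> simp

lemma qv_zero {m : ℕ} (u : Finset (Fin m) → ℝ) (x : ℕ) (h : m ≤ x) : qv u x = 0 := by
  unfold qv; simp [not_lt.2 h]

lemma u_eq {m : ℕ} {u : Finset (Fin m) → ℝ} (hu : BinaryAdditiveUtil u) (X : Finset (Fin m)) :
    u X = ((∑ x ∈ X, qv u x.val : ℕ) : ℝ) := by
  rw [hu.1 X]
  push_cast
  apply Finset.sum_congr rfl
  intro x _
  unfold qv
  rcases hu.2 x with h | h <;> simp [h]

lemma itv_sum (m : ℕ) (q : ℕ → ℕ) (a b : ℕ) (hab : a ≤ b) (hb : b ≤ m) :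
    (∑ x ∈ itv m a b, q x.val) + ∑ x ∈ range a, q x = ∑ x ∈ range b, q x := by
  have : ∑ x ∈ itv m a b, q x.val = ∑ x ∈ Finset.Ico a b, q x := by
    unfold itv
    rw [Finset.sum_filter, Fin.sum_univ_eq_sum_range (fun x => if a ≤ x ∧ x < b then q x else 0) m,
      ← Finset.sum_filter]
    apply Finset.sum_congr _ (fun _ _ => rfl)
    ext x; simp; omega
  rw [this, Finset.range_eq_Ico, Finset.range_eq_Ico, add_comm]
  exact Finset.sum_Ico_consecutive q (Nat.zero_le _) hab

lemma ef1_pair {m : ℕ} {u : Finset (Fin m) → ℝ} (hu : BinaryAdditiveUtil u)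
    (X Z : Finset (Fin m)) (hZ : Z ≠ ∅)
    (h : ∑ x ∈ Z, qv u x.val ≤ (∑ x ∈ X, qv u x.val) + 1) :
    ∃ v ∈ Z, 1 * u (Z.erase v) ≤ u X := by
  by_cases hz : ∃ v ∈ Z, qv u v.val ≠ 0
  · obtain ⟨v, hv, hq⟩ := hz
    refine ⟨v, hv, ?_⟩
    rw [one_mul, u_eq hu, u_eq hu]
    have := Finset.sum_erase_add Z (fun x : Fin m => qv u x.val) hv
    norm_cast
    omega
  · push Not at hz
    obtain ⟨v, hv⟩ := Finset.nonempty_iff_ne_empty.2 hZ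
    refine ⟨v, hv, ?_⟩
    rw [one_mul, u_eq hu, u_eq hu]
    rw [Finset.sum_eq_zero (fun x hx => hz x (Finset.mem_of_mem_erase hx))]
    rw [Nat.cast_zero]; exact Nat.cast_nonneg _

lemma pmms_pair {m : ℕ} {u : Finset (Fin m) → ℝ} (hu : BinaryAdditiveUtil u)
    (X Z : Finset (Fin m)) (H : SimpleGraph (Fin m))
    (h : ∑ x ∈ Z, qv u x.val ≤ (∑ x ∈ X, qv u x.val) + 1) :
    1 * pmms H u (X ∪ Z) ≤ u X := by
  rw [one_mul]
  unfold pmms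
  apply Real.sSup_le
  · rintro _ ⟨⟨A, B⟩, ⟨h1, h2, -, -⟩, rfl⟩
    simp only at h1 h2 ⊢
    have e1 : ∑ x ∈ A, qv u x.val + ∑ x ∈ B, qv u x.val = ∑ x ∈ X ∪ Z, qv u x.val := by
      rw [← h1, Finset.sum_union h2]
    have e2 := Finset.sum_union_inter (s₁ := X) (s₂ := Z) (f := fun x : Fin m => qv u x.val)
    rw [u_eq hu, u_eq hu, u_eq hu]
    norm_cast
    rw [min_le_iff]
    omega
  · rw [u_eq hu]; positivity

lemma finish {m n : ℕ} (u : Fin n → Finset (Fin m) → ℝ) (hu : ∀ i, BinaryAdditiveUtil (u i))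
    (A : Fin n → Finset (Fin m)) (hA : IsConnAlloc (SimpleGraph.pathGraph m) A)
    (h : ∀ i j, i ≠ j → ∑ x ∈ A j, qv (u i) x.val ≤ (∑ x ∈ A i, qv (u i) x.val) + 1) :
    ∃ A : Fin n → Finset (Fin m),
      IsConnAlloc (SimpleGraph.pathGraph m) A ∧
      IsAlphaPMMS (SimpleGraph.pathGraph m) u A 1 ∧
      IsAlphaEF1 u A 1 :=
  ⟨A, hA, fun i j hij _ => pmms_pair (hu i) _ _ _ (h i j hij),
    fun i j hij hne => ef1_pair (hu i) _ _ hne (h i j hij)⟩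

end GraphFair

open GraphFair in
/-- For a path graph and `n` agents with binary additive utility functions,
there exists a connected allocation that is simultaneously PMMS and EF1. -/
theorem exists_pmms_and_ef1_path_binary (m : ℕ) {n : ℕ} (hn : 0 < n)
    (u : Fin n → Finset (Fin m) → ℝ) (hu : ∀ i, BinaryAdditiveUtil (u i)) :
    ∃ A : Fin n → Finset (Fin m),
      IsConnAlloc (SimpleGraph.pathGraph m) A ∧
      IsAlphaPMMS (SimpleGraph.pathGraph m) u A 1 ∧
      IsAlphaEF1 u A 1 := by
  classical
  rcases Nat.eq_zero_or_pos m with hm | hm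
  · subst hm
    refine finish u hu (fun _ => ∅) ⟨fun v => v.elim0, fun _ _ _ => by simp, fun _ => Or.inl rfl⟩ ?_
    intro i j _; simp
  obtain hn1 | ⟨d, hd⟩ : n = 1 ∨ ∃ d, n = d + 2 := by
    by_cases h : n = 1
    · exact Or.inl h
    · exact Or.inr ⟨n - 2, by omega⟩
  · subst hn1
    refine finish u hu (fun _ => itv m 0 m) ⟨fun v => ⟨0, by simp [itv]⟩,
      fun i j hij => absurd (Subsingleton.elim i j) hij, fun _ => itv_conn m 0 m⟩ ?_
    intro i j hij
    exact absurd (Subsingleton.elim i j) hij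
  subst hd
  let p : Fin (d+2) → ℕ → ℕ := fun i => if ∃ x, qv (u i) x ≠ 0 then qv (u i) else
    fun x => if x = 0 then 1 else 0
  have pc : ∀ i, p i = qv (u i) ∨ ((∀ x, qv (u i) x = 0) ∧ p i = fun x => if x = 0 then 1 else 0) := by
    intro i
    by_cases h : ∃ x, qv (u i) x ≠ 0
    · left; simp only [p, if_pos h]
    · right; refine ⟨by push Not at h; exact h, ?_⟩
      simp only [p, if_neg h]
  obtain ⟨R, f, hf, hR0, hRn, hRm, hE⟩ := PathSperner.core d m hm p
    (by
      intro i x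
      rcases pc i with h | ⟨-, h⟩ <;> rw [h]
      · exact qv_le _ _
      · simp only; split_ifs <;> omega)
    (by
      intro i x hx
      rcases pc i with h | ⟨-, h⟩ <;> rw [h]
      · exact qv_zero _ _ hx
      · simp only; rw [if_neg (by omega)])
    (by
      intro i
      by_cases h : ∃ x, qv (u i) x ≠ 0
      · simp only [p, if_pos h]; exact h
      · simp only [p, if_neg h]; exact ⟨0, by simp⟩)
  have mono : ∀ a b, a ≤ b → b ≤ d + 2 → R a ≤ R b := by
    intro a b hab
    induction b, hab using Nat.le_induction with
    | base => intro _; exact le_rfl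
    | succ b hb ih => intro h; exact (ih (by omega)).trans (hRm b (by omega))
  have hle : ∀ b, b ≤ d + 2 → R b ≤ m := fun b hb => hRn ▸ mono b (d+2) hb le_rfl
  have hit : ∀ i (x : Fin m), x ∈ itv m (R (f i).val) (R ((f i).val+1)) ↔
      R (f i).val ≤ x.val ∧ x.val < R ((f i).val+1) := by
    intro i x; simp [itv]
  refine finish u hu (fun i => itv m (R (f i).val) (R ((f i).val+1))) ⟨?_, ?_, ?_⟩ ?_
  · intro x
    have hex : ∃ k, x.val < R k := ⟨d+2, by rw [hRn]; exact x.isLt⟩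
    have h1 := Nat.find_spec hex
    have h2 : Nat.find hex ≤ d + 2 := Nat.find_min' hex (by rw [hRn]; exact x.isLt)
    have h3 : Nat.find hex ≠ 0 := by
      intro e; rw [e, hR0] at h1; omega
    have h4 := Nat.find_min hex (m := Nat.find hex - 1) (by omega)
    obtain ⟨i, hi⟩ := hf.2 ⟨Nat.find hex - 1, by omega⟩
    refine ⟨i, ?_⟩
    rw [hit, hi]
    simp only
    rw [show Nat.find hex - 1 + 1 = Nat.find hex by omega]
    exact ⟨by omega, h1⟩
  · intro i j hij
    rw [Finset.disjoint_left]
    intro x hx hx'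
    rw [hit] at hx hx'
    have hne : (f i).val ≠ (f j).val := fun e => hij (hf.1 (Fin.ext e))
    have li := (f i).isLt
    have lj := (f j).isLt
    rcases Nat.lt_or_gt_of_ne hne with h | h
    · have := mono ((f i).val+1) (f j).val h (by omega); omega
    · have := mono ((f j).val+1) (f i).val h (by omega); omega
  · intro i; exact itv_conn _ _ _
  · intro i j hij
    rcases pc i with h | ⟨h, -⟩
    · have li := (f i).isLt
      have lj := (f j).isLt
      have e1 := itv_sum m (qv (u i)) (R (f i).val) (R ((f i).val+1)) (hRm _ (by omega))
        (hle _ (by omega))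
      have e2 := itv_sum m (qv (u i)) (R (f j).val) (R ((f j).val+1)) (hRm _ (by omega))
        (hle _ (by omega))
      have := hE i (f j)
      rw [h] at this
      omega
    · simp [h]
end
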